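/- Let 𝒜 = M(J,{n_k},{c_k}) and ℬ = M(I,{m_k},{d_k}) be Moran classes (with infima of the ratio sequences positive). Then: (i) if limsup_{k→∞} log(n_{k+1}⋯n_{k+k₀})/(−log(c_{k+1}⋯c_{k+k₀})) < 1 for some k₀ ≥ 1, then every E ∈ 𝒜 is uniformly disconnected; (ii) if E ∈ 𝒜 is uniformly disconnected and sup over all r, r' with r' < r₀·r < r < r₀ of log Φ_𝒜(r,r')/log Φ_ℬ(r,r') is strictly less than 1 for some r₀ < 1, then E can be bilipschitz embedded into every F ∈ ℬ; (iii) if E ∈ 𝒜 and F ∈ ℬ are both uniformly disconnected, then E and F are quasi-Lipschitz equivalent if and only if lim_{r→0} log Φ_𝒜(r)/log Φ_ℬ(r) = 1. -/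

import Mathlib

open scoped ENNReal

noncomputable section

open Filter MeasureTheory

/-- A compact set `A` is *homogeneous* with respect to the Borel probability measure `μ`
supported on `A` and constants `lam ≥ 1`, `kappa ∈ (0,1)`, `1 < del ≤ Del`. -/
structure IsHomog {X : Type*} [MetricSpace X] [MeasurableSpace X]
    (A : Set X) (μ : Measure X) (lam kappa del Del : ℝ) : Prop where
  compact : IsCompact A
  diam_pos : 0 < Metric.diam A
  prob : IsProbabilityMeasure μ
  supp_null : μ Aᶜ = 0
  supp_pos : ∀ x ∈ A, ∀ r : ℝ, 0 < r → 0 < μ (Metric.closedBall x r)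
  one_le_lam : 1 ≤ lam
  ratio_le : ∀ x₁ ∈ A, ∀ x₂ ∈ A, ∀ r : ℝ, 0 < r → r ≤ Metric.diam A →
    (μ (Metric.closedBall x₁ r)).toReal ≤ lam * (μ (Metric.closedBall x₂ r)).toReal
  kappa_pos : 0 < kappa
  kappa_lt_one : kappa < 1
  one_lt_del : 1 < del
  del_le_Del : del ≤ Del
  scale_lower : ∀ x ∈ A, ∀ r : ℝ, 0 < r → r ≤ Metric.diam A →
    del * (μ (Metric.closedBall x (kappa * r))).toReal ≤ (μ (Metric.closedBall x r)).toReal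
  scale_upper : ∀ x ∈ A, ∀ r : ℝ, 0 < r → r ≤ Metric.diam A →
    (μ (Metric.closedBall x r)).toReal ≤ Del * (μ (Metric.closedBall x (kappa * r))).toReal

/-- `alphaPt μ x r = log μ(B(x,r)) / log r`. -/
def alphaPt {X : Type*} [MetricSpace X] [MeasurableSpace X]
    (μ : Measure X) (x : X) (r : ℝ) : ℝ :=
  Real.log (μ (Metric.closedBall x r)).toReal / Real.log r

/-- `g ∼ h` : `|h r - g r| = O(1/|log r|)` as `r → 0⁺`. -/
def EquivNearZero (g h : ℝ → ℝ) : Prop :=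
  ∃ C : ℝ, 0 < C ∧ ∃ δ : ℝ, 0 < δ ∧ ∀ r : ℝ, 0 < r → r < δ → |h r - g r| ≤ C / |Real.log r|

/-- `g` is a representative of the equivalence class `[α_A(x,·)]` of the homogeneous set `A`. -/
def IsAlphaRep {X : Type*} [MetricSpace X] [MeasurableSpace X]
    (A : Set X) (μ : Measure X) (g : ℝ → ℝ) : Prop :=
  ∃ x ∈ A, EquivNearZero g (fun r => alphaPt μ x r)

/-- `χ(A,B)` computed from representatives `g` of `[α_A]` and `h` of `[α_B]`. -/
def chiFun (g h : ℝ → ℝ) : ℝ :=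
  Filter.limsup (fun r => |Real.log (g r / h r)|) (nhdsWithin (0 : ℝ) (Set.Ioi 0))

/-- `N(A,r)`: the smallest number of closed balls of radius `r` needed to cover `A`. -/
def coverNum {X : Type*} [MetricSpace X] (A : Set X) (r : ℝ) : ℕ :=
  sInf {m : ℕ | ∃ s : Finset X, s.card = m ∧ A ⊆ ⋃ x ∈ s, Metric.closedBall x r}

/-- Lower box-counting dimension. -/
def lowerBoxDim {X : Type*} [MetricSpace X] (A : Set X) : ℝ :=
  Filter.liminf (fun r : ℝ => Real.log (coverNum A r : ℝ) / (-Real.log r))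
    (nhdsWithin (0 : ℝ) (Set.Ioi 0))

/-- Upper box-counting dimension. -/
def upperBoxDim {X : Type*} [MetricSpace X] (A : Set X) : ℝ :=
  Filter.limsup (fun r : ℝ => Real.log (coverNum A r : ℝ) / (-Real.log r))
    (nhdsWithin (0 : ℝ) (Set.Ioi 0))

/-- Radius-based packing premeasure. -/
def packPre {X : Type*} [MetricSpace X] (A : Set X) (s : ℝ) : ℝ≥0∞ :=
  ⨅ (δ : ℝ) (_ : 0 < δ),
    ⨆ (m : ℕ) (x : Fin m → X) (ρ : Fin m → ℝ) (_ : ∀ i, x i ∈ A)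
      (_ : ∀ i, 0 < ρ i ∧ ρ i ≤ δ)
      (_ : ∀ i j, i ≠ j →
        Disjoint (Metric.closedBall (x i) (ρ i)) (Metric.closedBall (x j) (ρ j))),
      ∑ i, ENNReal.ofReal (ρ i ^ s)

/-- Radius-based packing measure. -/
def packMeasure {X : Type*} [MetricSpace X] (A : Set X) (s : ℝ) : ℝ≥0∞ :=
  ⨅ (F : ℕ → Set X) (_ : A ⊆ ⋃ m, F m), ∑' m, packPre (F m) s

/-- Radius-based packing dimension. -/
def packDim {X : Type*} [MetricSpace X] (A : Set X) : ℝ :=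
  sInf {s : ℝ | 0 ≤ s ∧ packMeasure A s = 0}

/-- Distance between two sets, valued in `ℝ≥0∞`. -/
def setDistE {X : Type*} [MetricSpace X] (E F : Set X) : ℝ≥0∞ :=
  ⨅ (a : X) (_ : a ∈ E) (b : X) (_ : b ∈ F), edist a b

/-- Uniformly disconnected set. -/
def UnifDisconn {X : Type*} [MetricSpace X] (A : Set X) : Prop :=
  ∃ C : ℝ, 1 < C ∧ ∃ rstar : ℝ, 0 < rstar ∧ ∀ x ∈ A, ∀ r : ℝ, 0 < r → r < rstar →
    ∃ E : Set X, E ⊆ A ∧ A ∩ Metric.closedBall x r ⊆ E ∧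
      E ⊆ Metric.closedBall x (C * r) ∧ ENNReal.ofReal r < setDistE E (A \ E)

/-- `A` can be bilipschitz embedded into `B`. -/
def BilipEmbed {X Y : Type*} [MetricSpace X] [MetricSpace Y] (A : Set X) (B : Set Y) : Prop :=
  ∃ (f : X → Y) (L : ℝ), 1 ≤ L ∧ Set.MapsTo f A B ∧ Set.InjOn f A ∧
    ∀ x₁ ∈ A, ∀ x₂ ∈ A,
      dist x₁ x₂ / L ≤ dist (f x₁) (f x₂) ∧ dist (f x₁) (f x₂) ≤ L * dist x₁ x₂

/-- `A` and `B` are bilipschitz equivalent. -/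
def BilipEquivSets {X Y : Type*} [MetricSpace X] [MetricSpace Y] (A : Set X) (B : Set Y) :
    Prop :=
  ∃ (f : X → Y) (L : ℝ), 1 ≤ L ∧ Set.BijOn f A B ∧
    ∀ x₁ ∈ A, ∀ x₂ ∈ A,
      dist x₁ x₂ / L ≤ dist (f x₁) (f x₂) ∧ dist (f x₁) (f x₂) ≤ L * dist x₁ x₂

/-- `A` and `B` are quasi-Lipschitz equivalent. -/
def QuasiLipEquiv {X Y : Type*} [MetricSpace X] [MetricSpace Y] (A : Set X) (B : Set Y) : Prop :=
  ∃ f : X → Y, Set.BijOn f A B ∧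
    ∀ ε : ℝ, 0 < ε → ∃ δ : ℝ, 0 < δ ∧ ∀ x₁ ∈ A, ∀ x₂ ∈ A,
      0 < dist x₁ x₂ → dist x₁ x₂ < δ →
      |Real.log (dist (f x₁) (f x₂)) / Real.log (dist x₁ x₂) - 1| < ε

/-- Ahlfors–David `s`-regular set. -/
def IsADRegular {X : Type*} [MetricSpace X] [MeasurableSpace X] (A : Set X) (s : ℝ) : Prop :=
  IsCompact A ∧ 0 < Metric.diam A ∧
    ∃ (μ : Measure X) (c : ℝ), 1 ≤ c ∧ μ Aᶜ = 0 ∧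
      ∀ x ∈ A, ∀ r : ℝ, 0 < r → r ≤ Metric.diam A →
        ENNReal.ofReal (c⁻¹ * r ^ s) ≤ μ (Metric.closedBall x r) ∧
          μ (Metric.closedBall x r) ≤ ENNReal.ofReal (c * r ^ s)

/-- `n₁ ⋯ n_k` (with `0`-based indexing of the sequence `n`). -/
def prodN (n : ℕ → ℕ) (k : ℕ) : ℕ := ∏ i ∈ Finset.range k, n i

/-- `c₁ ⋯ c_k` (with `0`-based indexing of the sequence `c`). -/
def prodC (c : ℕ → ℝ) (k : ℕ) : ℝ := ∏ i ∈ Finset.range k, c i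

/-- Admissible word for the branching sequence `n`. -/
def AdmWord (n : ℕ → ℕ) (w : List ℕ) : Prop := ∀ i : Fin w.length, w.get i < n i.val

/-- A Moran structure on `J ⊆ ℝ^d` with branching numbers `n` and ratios `c`:
`Jw w` is the basic set indexed by the word `w`. -/
structure IsMoranSystem {d : ℕ} (J : Set (EuclideanSpace ℝ (Fin d))) (n : ℕ → ℕ)
    (c : ℕ → ℝ) (Jw : List ℕ → Set (EuclideanSpace ℝ (Fin d))) : Prop where
  compact : IsCompact J
  int_nonempty : (interior J).Nonempty
  two_le_n : ∀ k, 2 ≤ n k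
  c_pos : ∀ k, 0 < c k
  c_lt_one : ∀ k, c k < 1
  c_inf_pos : ∃ c₀ : ℝ, 0 < c₀ ∧ ∀ k, c₀ ≤ c k
  root : Jw [] = J
  subset : ∀ w : List ℕ, AdmWord n w → ∀ i : ℕ, i < n w.length → Jw (w ++ [i]) ⊆ Jw w
  similar : ∀ w : List ℕ, AdmWord n w → ∀ i : ℕ, i < n w.length →
    ∃ S : EuclideanSpace ℝ (Fin d) → EuclideanSpace ℝ (Fin d),
      (∀ x y, dist (S x) (S y) = c w.length * dist x y) ∧ Jw (w ++ [i]) = S '' Jw w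
  disj_int : ∀ w : List ℕ, AdmWord n w → ∀ i : ℕ, i < n w.length → ∀ j : ℕ, j < n w.length →
    i ≠ j → Disjoint (interior (Jw (w ++ [i]))) (interior (Jw (w ++ [j])))

/-- The Moran set determined by the family `Jw`. -/
def moranSet {d : ℕ} (n : ℕ → ℕ) (Jw : List ℕ → Set (EuclideanSpace ℝ (Fin d))) :
    Set (EuclideanSpace ℝ (Fin d)) :=
  ⋂ k : ℕ, ⋃ (w : List ℕ) (_ : w.length = k ∧ AdmWord n w), Jw w

/-- The index `k` such that `(c₁⋯c_k)·D < r ≤ (c₁⋯c_{k-1})·D`. -/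
def levelOf (c : ℕ → ℝ) (D r : ℝ) : ℕ := sInf {k : ℕ | prodC c k * D < r}

/-- `Φ(r) = n₁⋯n_k` whenever `(c₁⋯c_k)·D < r ≤ (c₁⋯c_{k-1})·D`, where `D = |J|`. -/
def Phi (n : ℕ → ℕ) (c : ℕ → ℝ) (D r : ℝ) : ℕ := prodN n (levelOf c D r)

/-- Uniform bounds on the branching numbers and contraction ratios of a Moran class. -/
structure MoranData (n : ℕ → ℕ) (c : ℕ → ℝ) (D : ℝ) (M : ℕ) (c₀ γ : ℝ) : Prop where
  two_le : ∀ k, 2 ≤ n k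
  le_M : ∀ k, n k ≤ M
  c₀_pos : 0 < c₀
  le_c : ∀ k, c₀ ≤ c k
  c_le : ∀ k, c k ≤ γ
  γ_lt : γ < 1
  D_pos : 0 < D

namespace MoranData

variable {n : ℕ → ℕ} {c : ℕ → ℝ} {D : ℝ} {M : ℕ} {c₀ γ : ℝ}

lemma c_pos (h : MoranData n c D M c₀ γ) (k : ℕ) : 0 < c k := h.c₀_pos.trans_le (h.le_c k)

lemma γ_pos (h : MoranData n c D M c₀ γ) : 0 < γ := (h.c_pos 0).trans_le (h.c_le 0)

lemma c₀_lt (h : MoranData n c D M c₀ γ) : c₀ < 1 :=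
  ((h.le_c 0).trans (h.c_le 0)).trans_lt h.γ_lt

lemma two_le_M (h : MoranData n c D M c₀ γ) : 2 ≤ M := (h.two_le 0).trans (h.le_M 0)

lemma prodC_pos (h : MoranData n c D M c₀ γ) (k : ℕ) : 0 < prodC c k :=
  Finset.prod_pos fun i _ => h.c_pos i

lemma prodN_pos (h : MoranData n c D M c₀ γ) (k : ℕ) : 0 < prodN n k :=
  Finset.prod_pos fun i _ => by have := h.two_le i; omega

lemma log_M_pos (h : MoranData n c D M c₀ γ) : 0 < Real.log M :=
  Real.log_pos (by exact_mod_cast h.two_le_M)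

lemma neg_log_γ_pos (h : MoranData n c D M c₀ γ) : 0 < -Real.log γ := by
  have := Real.log_neg h.γ_pos h.γ_lt; linarith

lemma neg_log_c₀_pos (h : MoranData n c D M c₀ γ) : 0 < -Real.log c₀ := by
  have := Real.log_neg h.c₀_pos h.c₀_lt; linarith

lemma log_prodN_succ (h : MoranData n c D M c₀ γ) (k : ℕ) :
    Real.log (prodN n (k + 1)) = Real.log (prodN n k) + Real.log (n k) := by
  have h1 := h.prodN_pos k
  have h2 := h.two_le k
  rw [prodN, Finset.prod_range_succ, ← prodN, Nat.cast_mul, Real.log_mul] <;>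
    norm_cast <;> omega

lemma log_prodC_succ (h : MoranData n c D M c₀ γ) (k : ℕ) :
    Real.log (prodC c (k + 1)) = Real.log (prodC c k) + Real.log (c k) := by
  rw [prodC, Finset.prod_range_succ, ← prodC,
    Real.log_mul (h.prodC_pos k).ne' (h.c_pos k).ne']

lemma log_n_mem (h : MoranData n c D M c₀ γ) (k : ℕ) :
    Real.log 2 ≤ Real.log (n k) ∧ Real.log (n k) ≤ Real.log M := by
  have h2 := h.two_le k
  have h3 := h.le_M k
  constructor
  · exact Real.log_le_log (by norm_num) (by exact_mod_cast h2)
  · exact Real.log_le_log (by norm_cast; omega) (by exact_mod_cast h3)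

lemma log_c_mem (h : MoranData n c D M c₀ γ) (k : ℕ) :
    Real.log c₀ ≤ Real.log (c k) ∧ Real.log (c k) ≤ Real.log γ :=
  ⟨Real.log_le_log h.c₀_pos (h.le_c k), Real.log_le_log (h.c_pos k) (h.c_le k)⟩

lemma log_prodN_add (h : MoranData n c D M c₀ γ) (j l : ℕ) :
    l * Real.log 2 ≤ Real.log (prodN n (j + l)) - Real.log (prodN n j) ∧
      Real.log (prodN n (j + l)) - Real.log (prodN n j) ≤ l * Real.log M := by
  induction l with
  | zero => simp
  | succ l ih =>
    have h1 := h.log_n_mem (j + l)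
    rw [← add_assoc, h.log_prodN_succ]
    push_cast
    constructor <;> linarith [ih.1, ih.2, h1.1, h1.2]

lemma log_prodC_add (h : MoranData n c D M c₀ γ) (j l : ℕ) :
    l * -Real.log γ ≤ Real.log (prodC c j) - Real.log (prodC c (j + l)) ∧
      Real.log (prodC c j) - Real.log (prodC c (j + l)) ≤ l * -Real.log c₀ := by
  induction l with
  | zero => simp
  | succ l ih =>
    have h1 := h.log_c_mem (j + l)
    rw [← add_assoc, h.log_prodC_succ]
    push_cast
    constructor <;> linarith [ih.1, ih.2, h1.1, h1.2]

lemma log_prodN_mono (h : MoranData n c D M c₀ γ) {j j' : ℕ} (hj : j ≤ j') :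
    Real.log (prodN n j) ≤ Real.log (prodN n j') := by
  obtain ⟨l, rfl⟩ := Nat.exists_eq_add_of_le hj
  have := (h.log_prodN_add j l).1
  have : 0 ≤ l * Real.log 2 := by positivity
  linarith

lemma log_prodC_anti (h : MoranData n c D M c₀ γ) {j j' : ℕ} (hj : j ≤ j') :
    Real.log (prodC c j') ≤ Real.log (prodC c j) := by
  obtain ⟨l, rfl⟩ := Nat.exists_eq_add_of_le hj
  have := (h.log_prodC_add j l).1
  have : 0 ≤ l * -Real.log γ := mul_nonneg (by positivity) h.neg_log_γ_pos.le
  linarith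

lemma prodC_anti (h : MoranData n c D M c₀ γ) {j j' : ℕ} (hj : j ≤ j') :
    prodC c j' ≤ prodC c j :=
  (Real.log_le_log_iff (h.prodC_pos _) (h.prodC_pos _)).1 (h.log_prodC_anti hj)

lemma tendsto_log_prodC (h : MoranData n c D M c₀ γ) :
    Tendsto (fun k => Real.log (prodC c k)) atTop atBot := by
  have h1 : Tendsto (fun k : ℕ => (k : ℝ) * Real.log γ) atTop atBot :=
    tendsto_natCast_atTop_atTop.atTop_mul_const_of_neg (Real.log_neg h.γ_pos h.γ_lt)
  refine tendsto_atBot_mono (fun k => ?_) h1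
  have := (h.log_prodC_add 0 k).1
  simp only [zero_add, prodC, Finset.range_zero, Finset.prod_empty, Real.log_one] at this ⊢
  linarith

lemma tendsto_prodC (h : MoranData n c D M c₀ γ) :
    Tendsto (fun k => prodC c k) atTop (nhds 0) := by
  have := Real.tendsto_exp_atBot.comp h.tendsto_log_prodC
  refine this.congr fun k => ?_
  simp [Real.exp_log (h.prodC_pos k)]

lemma levelOf_spec (h : MoranData n c D M c₀ γ) {r : ℝ} (hr : 0 < r) :
    prodC c (levelOf c D r) * D < r := by
  have h1 : Tendsto (fun k => prodC c k * D) atTop (nhds 0) := by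
    simpa using h.tendsto_prodC.mul_const D
  obtain ⟨k, hk⟩ := (h1.eventually (gt_mem_nhds hr)).exists
  exact Nat.sInf_mem (s := {k : ℕ | prodC c k * D < r}) ⟨k, hk⟩

lemma levelOf_anti (h : MoranData n c D M c₀ γ) {r r' : ℝ} (hr : 0 < r') (hrr : r' ≤ r) :
    levelOf c D r ≤ levelOf c D r' :=
  Nat.sInf_le ((h.levelOf_spec hr).trans_le hrr)

lemma levelOf_eq_zero {r : ℝ} (hr : D < r) : levelOf c D r = 0 := by
  have : levelOf c D r ≤ 0 := Nat.sInf_le (by simpa [prodC] using hr)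
  omega

lemma le_prodC_levelOf (h : MoranData n c D M c₀ γ) {r : ℝ} :
    levelOf c D r = 0 ∨ c₀ * r ≤ prodC c (levelOf c D r) * D := by
  rcases Nat.eq_zero_or_pos (levelOf c D r) with h0 | h0
  · exact .inl h0
  right
  obtain ⟨k, hk⟩ : ∃ k, levelOf c D r = k + 1 := ⟨_, (Nat.succ_pred_eq_of_pos h0).symm⟩
  have h1 : ¬ prodC c k * D < r := fun hlt => by
    have : levelOf c D r ≤ k := Nat.sInf_le hlt
    omega
  rw [hk, prodC, Finset.prod_range_succ, ← prodC]
  have h2 := h.le_c k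
  have h3 := h.c₀_pos
  have := h.prodC_pos k
  have := h.D_pos
  nlinarith [mul_le_mul_of_nonneg_left (not_lt.1 h1) h3.le,
    mul_le_mul_of_nonneg_right h2 (mul_pos (h.prodC_pos k) h.D_pos).le]

lemma le_prodC_levelOf_of_le (h : MoranData n c D M c₀ γ) {r : ℝ} (hr : r ≤ D) :
    c₀ * r ≤ prodC c (levelOf c D r) * D := by
  rcases h.le_prodC_levelOf (r := r) with h0 | h0
  · rw [h0]
    simp only [prodC, Finset.range_zero, Finset.prod_empty]
    nlinarith [h.c₀_lt, h.c₀_pos, h.D_pos]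
  · exact h0

lemma prodN_mul_prod_Ico (n : ℕ → ℕ) {j j' : ℕ} (hj : j ≤ j') :
    prodN n j * ∏ i ∈ Finset.Ico j j', n i = prodN n j' :=
  Finset.prod_range_mul_prod_Ico _ hj

lemma prod_Ico_pos (h : MoranData n c D M c₀ γ) (j j' : ℕ) :
    0 < ∏ i ∈ Finset.Ico j j', n i :=
  Finset.prod_pos fun i _ => by have := h.two_le i; omega

lemma log_prod_Ico (h : MoranData n c D M c₀ γ) {j j' : ℕ} (hj : j ≤ j') :
    Real.log ((∏ i ∈ Finset.Ico j j', n i : ℕ) : ℝ) =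
      Real.log (prodN n j') - Real.log (prodN n j) := by
  have h1 := h.prodN_pos j
  have h2 := h.prod_Ico_pos j j'
  rw [← prodN_mul_prod_Ico n hj, Nat.cast_mul (prodN n j), Real.log_mul]
  · ring
  · exact_mod_cast h1.ne'
  · exact_mod_cast h2.ne'

/-- `log Φ` grows at most linearly in `-log r`, on increments. -/
lemma log_Phi_sub_le (h : MoranData n c D M c₀ γ) :
    ∃ κ κ' : ℝ, 0 < κ ∧ 0 < κ' ∧ ∀ r r' : ℝ, 0 < r' → r' ≤ r →
      Real.log (Phi n c D r') - Real.log (Phi n c D r) ≤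
        κ * (Real.log r - Real.log r') + κ' := by
  have hγ := h.neg_log_γ_pos
  have hM := h.log_M_pos
  have hc := h.neg_log_c₀_pos
  refine ⟨Real.log M / -Real.log γ, Real.log M / -Real.log γ * -Real.log c₀,
    by positivity, by positivity, fun r r' hr' hrr => ?_⟩
  have hr : 0 < r := hr'.trans_le hrr
  have hl := h.levelOf_anti hr' hrr
  rcases h.le_prodC_levelOf (r := r') with h0 | h0
  · have : levelOf c D r = 0 := by omega
    rw [Phi, Phi, this, h0, sub_self]
    have : Real.log r' ≤ Real.log r := Real.log_le_log hr' hrr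
    have : 0 ≤ Real.log r - Real.log r' := by linarith
    positivity
  obtain ⟨l, hl⟩ := Nat.exists_eq_add_of_le hl
  have h1 := (h.log_prodN_add (levelOf c D r) l).2
  have h2 := (h.log_prodC_add (levelOf c D r) l).1
  rw [← hl] at h1 h2
  have h3 := Real.log_lt_log (mul_pos (h.prodC_pos _) h.D_pos) (h.levelOf_spec hr)
  have h4 := Real.log_le_log (mul_pos h.c₀_pos hr') h0
  rw [Real.log_mul (h.prodC_pos _).ne' h.D_pos.ne'] at h3 h4
  rw [Real.log_mul h.c₀_pos.ne' hr'.ne'] at h4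
  refine h1.trans ?_
  have h5 : (l : ℝ) ≤ (Real.log r - Real.log r' + -Real.log c₀) / -Real.log γ := by
    rw [le_div_iff₀ hγ]; linarith
  calc (l : ℝ) * Real.log M ≤ _ := mul_le_mul_of_nonneg_right h5 hM.le
    _ = _ := by ring

/-- `log Φ` grows at least linearly in `-log r`, on increments. -/
lemma le_log_Phi_sub (h : MoranData n c D M c₀ γ) (R : ℝ) :
    ∃ κ κ' : ℝ, 0 < κ ∧ 0 < κ' ∧ ∀ r r' : ℝ, 0 < r' → r' ≤ r → r ≤ R →
      κ * (Real.log r - Real.log r') - κ' ≤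
      Real.log (Phi n c D r') - Real.log (Phi n c D r) := by
  have hc := h.neg_log_c₀_pos
  have h2 : 0 < Real.log 2 := Real.log_pos (by norm_num)
  have hκ : 0 < Real.log 2 / -Real.log c₀ := by positivity
  refine ⟨Real.log 2 / -Real.log c₀,
    Real.log 2 / -Real.log c₀ * (-Real.log c₀ + |Real.log R - Real.log D|),
    hκ, by positivity, fun r r' hr' hrr hR => ?_⟩
  have hr : 0 < r := hr'.trans_le hrr
  obtain ⟨l, hl⟩ := Nat.exists_eq_add_of_le (h.levelOf_anti hr' hrr)
  have h1 := (h.log_prodN_add (levelOf c D r) l).1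
  have h2' := (h.log_prodC_add (levelOf c D r) l).2
  rw [← hl] at h1 h2'
  have h3 := Real.log_lt_log (mul_pos (h.prodC_pos _) h.D_pos) (h.levelOf_spec hr')
  rw [Real.log_mul (h.prodC_pos _).ne' h.D_pos.ne'] at h3
  have h4 : Real.log r - (-Real.log c₀ + |Real.log R - Real.log D|) ≤
      Real.log (prodC c (levelOf c D r)) + Real.log D := by
    rcases h.le_prodC_levelOf (r := r) with h0 | h0
    · rw [h0]
      simp only [prodC, Finset.range_zero, Finset.prod_empty, Real.log_one]
      have := Real.log_le_log hr hR
      have := le_abs_self (Real.log R - Real.log D)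
      linarith
    · have h4 := Real.log_le_log (mul_pos h.c₀_pos hr) h0
      rw [Real.log_mul (h.prodC_pos _).ne' h.D_pos.ne', Real.log_mul h.c₀_pos.ne' hr.ne'] at h4
      have := abs_nonneg (Real.log R - Real.log D)
      linarith
  refine le_trans ?_ h1
  have h5 : (Real.log r - Real.log r' - (-Real.log c₀ + |Real.log R - Real.log D|)) /
      -Real.log c₀ ≤ l := by
    rw [div_le_iff₀ hc]; linarith
  calc _ = (Real.log r - Real.log r' - (-Real.log c₀ + |Real.log R - Real.log D|)) /
      -Real.log c₀ * Real.log 2 := by ring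
    _ ≤ _ := mul_le_mul_of_nonneg_right h5 h2.le

end MoranData

open scoped Pointwise in
/-- A similarity of Euclidean space is a homeomorphism that scales volume. -/
lemma exists_homeomorph_of_similarity {d : ℕ}
    {S : EuclideanSpace ℝ (Fin d) → EuclideanSpace ℝ (Fin d)} {c : ℝ} (hc : 0 < c)
    (hS : ∀ x y, dist (S x) (S y) = c * dist x y) :
    (∃ T : EuclideanSpace ℝ (Fin d) ≃ₜ EuclideanSpace ℝ (Fin d), ⇑T = S) ∧
      ∀ U : Set (EuclideanSpace ℝ (Fin d)), IsOpen U →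
        volume (S '' U) = ENNReal.ofReal (c ^ d) * volume U := by
  have hiso : Isometry (fun x => c⁻¹ • S x) := Isometry.of_dist_eq fun x y => by
    rw [dist_smul₀, hS, Real.norm_of_nonneg (inv_nonneg.2 hc.le), ← mul_assoc,
      inv_mul_cancel₀ hc.ne', one_mul]
  let L := hiso.affineIsometryOfStrictConvexSpace.linearIsometry.toLinearIsometryEquiv rfl
  let v := c⁻¹ • S 0
  have hSL : ∀ x, S x = c • (L x + v) := by
    intro x
    have h1 := hiso.affineIsometryOfStrictConvexSpace.map_vadd 0 x
    simp only [vadd_eq_add, add_zero, Isometry.coe_affineIsometryOfStrictConvexSpace] at h1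
    have h2 : L x + v = c⁻¹ • S x := h1.symm
    rw [h2, smul_inv_smul₀ hc.ne']
  refine ⟨⟨(L.toHomeomorph.trans (Homeomorph.addRight v)).trans
    (Homeomorph.smulOfNeZero c hc.ne'), ?_⟩, fun U hU => ?_⟩
  · ext1 x
    rw [hSL]
    rfl
  · have him : S '' U = c • ((fun y => y + v) '' (L '' U)) := by
      rw [← Set.image_smul, Set.image_image, Set.image_image]
      exact Set.image_congr fun x _ => hSL x
    rw [him, Measure.addHaar_smul, finrank_euclideanSpace_fin, abs_of_pos (pow_pos hc d),
      Set.image_add_right, measure_preimage_add_right]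
    congr 1
    have : L '' U = L.symm ⁻¹' U := L.toEquiv.image_eq_preimage_symm U
    rw [this, L.symm.measurePreserving.measure_preimage hU.measurableSet.nullMeasurableSet]

/-- The metric content of a Moran construction, coded by infinite words `σ`: `P k σ` is the basic
set of level `k` containing the point coded by `σ`. -/
structure MoranCoding {X : Type*} [MetricSpace X] (A : Set X) (n : ℕ → ℕ) (c : ℕ → ℝ) (D : ℝ)
    (P : ℕ → (∀ i, Fin (n i)) → Set X) : Prop where
  compact_set : IsCompact A
  compact : ∀ k σ, IsCompact (P k σ)
  nonempty : ∀ k σ, (P k σ).Nonempty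
  anti : ∀ k σ, P (k + 1) σ ⊆ P k σ
  congr : ∀ k σ τ, (∀ i < k, σ i = τ i) → P k σ = P k τ
  diam : ∀ k σ, ∀ x ∈ P k σ, ∀ y ∈ P k σ, dist x y ≤ prodC c k * D
  code : ∀ x, x ∈ A ↔ ∃ σ, ∀ k, x ∈ P k σ
  mem_of : ∀ x, (∀ k, ∃ σ, x ∈ P k σ) → x ∈ A
  pack : ∀ K : ℝ, ∃ N : ℕ, ∀ k x (S : Finset (∀ i, Fin (n i))),
    (∀ σ ∈ S, (P k σ ∩ Metric.closedBall x (K * prodC c k)).Nonempty) →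
    (∀ σ ∈ S, ∀ τ ∈ S, (∀ i < k, σ i = τ i) → σ = τ) → S.card ≤ N

/-- The first `k` letters of an infinite word. -/
def prefixWord {n : ℕ → ℕ} (σ : ∀ i, Fin (n i)) (k : ℕ) : List ℕ :=
  (List.range k).map fun i => (σ i : ℕ)

section prefixWord

variable {n : ℕ → ℕ} (σ τ : ∀ i, Fin (n i))

@[simp] lemma length_prefixWord (k : ℕ) : (prefixWord σ k).length = k := by simp [prefixWord]

lemma prefixWord_succ (k : ℕ) : prefixWord σ (k + 1) = prefixWord σ k ++ [(σ k : ℕ)] := by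
  simp [prefixWord, List.range_succ]

lemma admWord_prefixWord (k : ℕ) : AdmWord n (prefixWord σ k) := by
  intro i
  have h : (prefixWord σ k).get i = σ i := by
    have hf : ∀ (f : ℕ → ℕ) (i : ℕ) (hi : i < ((List.range k).map f).length),
        ((List.range k).map f)[i] = f i := by simp
    exact hf (fun i => (σ i : ℕ)) i i.isLt
  rw [h]
  exact (σ i).isLt

lemma prefixWord_congr {k : ℕ} (h : ∀ i < k, σ i = τ i) : prefixWord σ k = prefixWord τ k := by
  refine List.map_congr_left fun i hi => ?_
  rw [h i (List.mem_range.1 hi)]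

lemma exists_prefixWord_eq (hn : ∀ k, 2 ≤ n k) {w : List ℕ} (hw : AdmWord n w) :
    ∃ σ : ∀ i, Fin (n i), prefixWord σ w.length = w := by
  refine ⟨fun i => if h : i < w.length then ⟨w.get ⟨i, h⟩, hw ⟨i, h⟩⟩
    else ⟨0, by have := hn i; omega⟩, ?_⟩
  refine List.ext_getElem (by simp) fun i h1 h2 => ?_
  simp [prefixWord, h2]

end prefixWord

namespace IsMoranSystem

variable {d : ℕ} {J : Set (EuclideanSpace ℝ (Fin d))} {n : ℕ → ℕ} {c : ℕ → ℝ}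
  {Jw : List ℕ → Set (EuclideanSpace ℝ (Fin d))}

lemma prodC_pos (h : IsMoranSystem J n c Jw) (k : ℕ) : 0 < prodC c k :=
  Finset.prod_pos fun i _ => h.c_pos i

lemma exists_similarity (h : IsMoranSystem J n c Jw) (σ : ∀ i, Fin (n i)) (k : ℕ) :
    ∃ S : EuclideanSpace ℝ (Fin d) → EuclideanSpace ℝ (Fin d),
      (∀ x y, dist (S x) (S y) = prodC c k * dist x y) ∧ Jw (prefixWord σ k) = S '' J := by
  induction k with
  | zero => exact ⟨id, by simp [prodC], by simp [prefixWord, h.root]⟩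
  | succ k ih =>
    obtain ⟨S, hS, hSJ⟩ := ih
    obtain ⟨T, hT, hTJ⟩ := h.similar (prefixWord σ k) (admWord_prefixWord σ k) (σ k)
      (by simp)
    refine ⟨T ∘ S, fun x y => ?_, ?_⟩
    · simp only [Function.comp, hT, hS, length_prefixWord]
      rw [prodC, prodC, Finset.prod_range_succ]
      ring
    · rw [prefixWord_succ, hTJ, hSJ, Set.image_image]
      rfl

lemma volume_interior (h : IsMoranSystem J n c Jw) (σ : ∀ i, Fin (n i)) (k : ℕ) :
    volume (interior (Jw (prefixWord σ k))) =
      ENNReal.ofReal (prodC c k ^ d) * volume (interior J) := by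
  obtain ⟨S, hS, hSJ⟩ := h.exists_similarity σ k
  obtain ⟨⟨T, rfl⟩, hv⟩ := exists_homeomorph_of_similarity (h.prodC_pos k) hS
  rw [hSJ, ← hv _ isOpen_interior, T.image_interior]

lemma volume_pos (h : IsMoranSystem J n c Jw) : 0 < volume (interior J) :=
  isOpen_interior.measure_pos _ h.int_nonempty

lemma volume_lt_top (h : IsMoranSystem J n c Jw) : volume (interior J) < ∞ :=
  (measure_mono interior_subset).trans_lt h.compact.measure_lt_top

lemma subset_succ (h : IsMoranSystem J n c Jw) (σ : ∀ i, Fin (n i)) (k : ℕ) :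
    Jw (prefixWord σ (k + 1)) ⊆ Jw (prefixWord σ k) := by
  rw [prefixWord_succ]
  exact h.subset _ (admWord_prefixWord σ k) _ (by simp)

lemma subset_of_le (h : IsMoranSystem J n c Jw) (σ : ∀ i, Fin (n i)) {j k : ℕ} (hjk : j ≤ k) :
    Jw (prefixWord σ k) ⊆ Jw (prefixWord σ j) :=
  antitone_nat_of_succ_le (f := fun k => Jw (prefixWord σ k)) (h.subset_succ σ) hjk

lemma disjoint_interior (h : IsMoranSystem J n c Jw) (σ τ : ∀ i, Fin (n i)) (k : ℕ)
    (hne : ¬ ∀ i < k, σ i = τ i) :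
    Disjoint (interior (Jw (prefixWord σ k))) (interior (Jw (prefixWord τ k))) := by
  classical
  push Not at hne
  let l := Nat.find hne
  obtain ⟨hlk, hl⟩ : l < k ∧ σ l ≠ τ l := Nat.find_spec hne
  have hmin : ∀ i < l, σ i = τ i := fun i hi => by
    have := Nat.find_min hne hi
    push Not at this
    exact this (hi.trans hlk)
  have h1 := h.disj_int (prefixWord σ l) (admWord_prefixWord σ l) (σ l) (by simp)
    (τ l) (by simp) (by simpa [Fin.val_eq_val] using hl)
  rw [← prefixWord_succ, prefixWord_congr σ τ hmin, ← prefixWord_succ] at h1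
  exact h1.mono (interior_mono (h.subset_of_le σ hlk)) (interior_mono (h.subset_of_le τ hlk))

lemma card_mul_le (h : IsMoranSystem J n c Jw) (k : ℕ) (S : Finset (∀ i, Fin (n i)))
    (hS : ∀ σ ∈ S, ∀ τ ∈ S, (∀ i < k, σ i = τ i) → σ = τ)
    {B : Set (EuclideanSpace ℝ (Fin d))} (hB : ∀ σ ∈ S, interior (Jw (prefixWord σ k)) ⊆ B) :
    S.card * (ENNReal.ofReal (prodC c k ^ d) * volume (interior J)) ≤ volume B := by
  calc _ = ∑ σ ∈ S, volume (interior (Jw (prefixWord σ k))) := by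
        rw [Finset.sum_congr rfl fun σ _ => h.volume_interior σ k]
        simp
    _ = volume (⋃ σ ∈ S, interior (Jw (prefixWord σ k))) := by
        refine (measure_biUnion_finset (fun σ hσ τ hτ hne => ?_)
          fun σ _ => isOpen_interior.measurableSet).symm
        exact h.disjoint_interior σ τ k fun hst => hne (hS σ hσ τ hτ hst)
    _ ≤ volume B := measure_mono (Set.iUnion₂_subset hB)

lemma n_mul_pow_le (h : IsMoranSystem J n c Jw) (k : ℕ) : (n k : ℝ) * c k ^ d ≤ 1 := by
  classical
  have hn := h.two_le_n
  let z : ∀ i, Fin (n i) := fun i => ⟨0, by have := hn i; omega⟩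
  let S : Finset (∀ i, Fin (n i)) := Finset.univ.image fun a : Fin (n k) => Function.update z k a
  have hcard : S.card = n k := by
    rw [Finset.card_image_of_injective _ (Function.update_injective z k)]
    simp
  have h1 := h.card_mul_le (k + 1) S (B := interior (Jw (prefixWord z k))) (by
    intro σ hσ τ hτ hst
    obtain ⟨a, -, rfl⟩ := Finset.mem_image.1 hσ
    obtain ⟨b, -, rfl⟩ := Finset.mem_image.1 hτ
    have := hst k (by omega)
    simp only [Function.update_self] at this
    rw [this]) (by
    intro σ hσ
    obtain ⟨a, -, rfl⟩ := Finset.mem_image.1 hσ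
    refine interior_mono ((h.subset_succ _ k).trans_eq ?_)
    rw [prefixWord_congr _ z]
    intro i hi
    rw [Function.update_of_ne hi.ne])
  rw [h.volume_interior z k, hcard, ← mul_assoc,
    ENNReal.mul_le_mul_iff_left h.volume_pos.ne' h.volume_lt_top.ne] at h1
  rw [← ENNReal.ofReal_natCast, ← ENNReal.ofReal_mul (by positivity),
    ENNReal.ofReal_le_ofReal_iff (pow_pos (h.prodC_pos k) d).le] at h1
  have h2 := pow_pos (h.prodC_pos k) d
  rw [prodC, Finset.prod_range_succ, ← prodC, mul_pow] at h1
  have : (n k : ℝ) * c k ^ d * prodC c k ^ d ≤ 1 * prodC c k ^ d := by linarith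
  exact le_of_mul_le_mul_right this h2

lemma diam_pos (h : IsMoranSystem J n c Jw) : 0 < Metric.diam J := by
  have hn := h.two_le_n
  have hJ : J.Nonempty := h.int_nonempty.mono interior_subset
  let z : ∀ i, Fin (n i) := fun i => ⟨0, by have := hn i; omega⟩
  let o : ∀ i, Fin (n i) := fun i => ⟨1, by have := hn i; omega⟩
  have hpos : ∀ σ : ∀ i, Fin (n i), (interior (Jw (prefixWord σ 1))).Nonempty := fun σ => by
    refine nonempty_of_measure_ne_zero (μ := volume) ?_
    rw [h.volume_interior σ 1]
    refine mul_ne_zero ?_ h.volume_pos.ne'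
    simpa using pow_pos (h.prodC_pos 1) d
  have hJs : ∀ σ : ∀ i, Fin (n i), interior (Jw (prefixWord σ 1)) ⊆ J := fun σ => by
    refine interior_subset.trans ((h.subset_of_le σ zero_le_one).trans_eq ?_)
    simp [prefixWord, h.root]
  obtain ⟨x, hx⟩ := hpos z
  obtain ⟨y, hy⟩ := hpos o
  have hdis := h.disjoint_interior z o 1 (by
    push Not
    exact ⟨0, one_pos, by simp [z, o]⟩)
  have hxy : x ≠ y := fun hxy => Set.disjoint_left.1 hdis hx (hxy ▸ hy)
  exact (dist_pos.2 hxy).trans_le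
    (Metric.dist_le_diam_of_mem h.compact.isBounded (hJs z hx) (hJs o hy))

lemma exists_moranData (h : IsMoranSystem J n c Jw) :
    ∃ (M : ℕ) (c₀ γ : ℝ), MoranData n c (Metric.diam J) M c₀ γ := by
  obtain ⟨c₀, hc₀, hc⟩ := h.c_inf_pos
  have hd : d ≠ 0 := by
    rintro rfl
    have h1 := h.n_mul_pow_le 0
    have h2 : (2 : ℝ) ≤ n 0 := by exact_mod_cast h.two_le_n 0
    simp only [pow_zero, mul_one] at h1
    linarith
  have hd0 : (0 : ℝ) < d := by positivity
  refine ⟨⌈1 / c₀ ^ d⌉₊, c₀, 1 - 1 / (2 * (d + 1)), h.two_le_n, fun k => ?_, hc₀, hc, fun k => ?_,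
    ?_, h.diam_pos⟩
  · have h1 := h.n_mul_pow_le k
    have h2 : c₀ ^ d ≤ c k ^ d := pow_le_pow_left₀ hc₀.le (hc k) d
    have h3 : (n k : ℝ) ≤ 1 / c₀ ^ d := by
      rw [le_div_iff₀ (by positivity)]
      exact (mul_le_mul_of_nonneg_left h2 (by positivity)).trans h1
    exact_mod_cast h3.trans (Nat.le_ceil _)
  · by_contra hlt
    push Not at hlt
    have h1 := h.n_mul_pow_le k
    have h2 : (2 : ℝ) ≤ n k := by exact_mod_cast h.two_le_n k
    have hb := one_add_mul_le_pow (a := -(1 / (2 * ((d : ℝ) + 1)))) (by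
      have : 1 / (2 * ((d : ℝ) + 1)) ≤ 1 := by
        rw [div_le_one (by positivity)]; linarith
      linarith) d
    have h3 : (1 + -(1 / (2 * ((d : ℝ) + 1)))) ^ d ≤ c k ^ d := by
      refine pow_le_pow_left₀ ?_ (by linarith) d
      have : 1 / (2 * ((d : ℝ) + 1)) ≤ 1 := by
        rw [div_le_one (by positivity)]; linarith
      linarith
    have h4 : (d : ℝ) * (1 / (2 * ((d : ℝ) + 1))) < 1 / 2 := by
      rw [mul_one_div, div_lt_div_iff₀ (by positivity) (by positivity)]
      linarith
    have h5 : 1 / 2 < c k ^ d := by linarith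
    nlinarith
  · have : 0 < 1 / (2 * ((d : ℝ) + 1)) := by positivity
    linarith

lemma exists_pack (h : IsMoranSystem J n c Jw) (K : ℝ) :
    ∃ N : ℕ, ∀ k x (S : Finset (∀ i, Fin (n i))),
      (∀ σ ∈ S, (Jw (prefixWord σ k) ∩ Metric.closedBall x (K * prodC c k)).Nonempty) →
      (∀ σ ∈ S, ∀ τ ∈ S, (∀ i < k, σ i = τ i) → σ = τ) → S.card ≤ N := by
  have hV := h.volume_pos
  have hVt := h.volume_lt_top
  have hW : volume (Metric.closedBall (0 : EuclideanSpace ℝ (Fin d)) 1) < ∞ :=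
    measure_closedBall_lt_top
  set V := volume (interior J) with hVdef
  set W := volume (Metric.closedBall (0 : EuclideanSpace ℝ (Fin d)) 1) with hWdef
  set D := Metric.diam J
  have hD : 0 < D := h.diam_pos
  refine ⟨⌈(|K| + D) ^ d * W.toReal / V.toReal⌉₊, fun k x S hS hinj => ?_⟩
  have hr := h.prodC_pos k
  have h1 := h.card_mul_le k S hinj (B := Metric.closedBall x (prodC c k * (|K| + D))) (by
    intro σ hσ y hy
    obtain ⟨z, hz, hzx⟩ := hS σ hσ
    obtain ⟨T, hT, hTJ⟩ := h.exists_similarity σ k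
    have hy' := interior_subset hy
    rw [hTJ] at hz hy'
    obtain ⟨a, ha, rfl⟩ := hz
    obtain ⟨b, hb, rfl⟩ := hy'
    have h2 : dist (T b) (T a) ≤ prodC c k * D := by
      rw [hT]
      exact mul_le_mul_of_nonneg_left (Metric.dist_le_diam_of_mem h.compact.isBounded hb ha) hr.le
    rw [Metric.mem_closedBall] at hzx ⊢
    have h3 := dist_triangle (T b) (T a) x
    nlinarith [le_abs_self K])
  rw [Measure.addHaar_closedBall_mul _ _ hr.le (by positivity),
    Measure.addHaar_closedBall' _ _ (by positivity), finrank_euclideanSpace_fin, ← hVdef,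
    ← hWdef] at h1
  have h2 := ENNReal.toReal_mono (by finiteness) h1
  simp only [ENNReal.toReal_mul, ENNReal.toReal_natCast] at h2
  rw [ENNReal.toReal_ofReal (by positivity), ENNReal.toReal_ofReal (by positivity)] at h2
  have hV' : 0 < V.toReal := ENNReal.toReal_pos hV.ne' hVt.ne
  have h3 : (S.card : ℝ) ≤ (|K| + D) ^ d * W.toReal / V.toReal := by
    rw [le_div_iff₀ hV']
    have hp : 0 < prodC c k ^ d := by positivity
    refine le_of_mul_le_mul_left ?_ hp
    linarith
  exact_mod_cast h3.trans (Nat.le_ceil _)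

lemma exists_code (h : IsMoranSystem J n c Jw) {x : EuclideanSpace ℝ (Fin d)}
    (hx : ∀ k, ∃ σ : ∀ i, Fin (n i), x ∈ Jw (prefixWord σ k)) :
    ∃ σ : ∀ i, Fin (n i), ∀ k, x ∈ Jw (prefixWord σ k) := by
  have hopen : ∀ (s : ℕ), IsClosed {σ : ∀ i, Fin (n i) | x ∈ Jw (prefixWord σ s)} := by
    intro s
    have hcont : Continuous (fun σ : ∀ i, Fin (n i) => fun i : Fin s => σ i) := by fun_prop
    have : {σ : ∀ i, Fin (n i) | x ∈ Jw (prefixWord σ s)} =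
        (fun σ : ∀ i, Fin (n i) => fun i : Fin s => σ i) ⁻¹'
          ((fun σ : ∀ i, Fin (n i) => fun i : Fin s => σ i) ''
            {σ : ∀ i, Fin (n i) | x ∈ Jw (prefixWord σ s)}) := by
      refine Set.Subset.antisymm (Set.subset_preimage_image _ _) ?_
      rintro σ ⟨τ, hτ, hst⟩
      change x ∈ Jw (prefixWord τ s) at hτ
      change x ∈ Jw (prefixWord σ s)
      rwa [← prefixWord_congr τ σ fun i hi => congrFun hst ⟨i, hi⟩]
    rw [this]
    exact (isClosed_discrete _).preimage hcont
  obtain ⟨σ, hσ⟩ := IsCompact.nonempty_iInter_of_sequence_nonempty_isCompact_isClosed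
    (fun s => {σ : ∀ i, Fin (n i) | x ∈ Jw (prefixWord σ s)})
    (fun s σ hσ => h.subset_succ σ s hσ) (fun s => hx s) (hopen 0).isCompact hopen
  exact ⟨σ, fun k => Set.mem_iInter.1 hσ k⟩

lemma mem_moranSet_iff (h : IsMoranSystem J n c Jw) {x : EuclideanSpace ℝ (Fin d)} :
    x ∈ moranSet n Jw ↔ ∀ k, ∃ σ : ∀ i, Fin (n i), x ∈ Jw (prefixWord σ k) := by
  simp only [moranSet, Set.mem_iInter, Set.mem_iUnion]
  refine forall_congr' fun k => ⟨?_, ?_⟩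
  · rintro ⟨w, ⟨rfl, hw⟩, hx⟩
    obtain ⟨σ, hσ⟩ := exists_prefixWord_eq h.two_le_n hw
    exact ⟨σ, hσ.symm ▸ hx⟩
  · rintro ⟨σ, hσ⟩
    exact ⟨_, ⟨length_prefixWord σ k, admWord_prefixWord σ k⟩, hσ⟩

lemma isCompact_piece (h : IsMoranSystem J n c Jw) (σ : ∀ i, Fin (n i)) (k : ℕ) :
    IsCompact (Jw (prefixWord σ k)) := by
  obtain ⟨S, hS, hSJ⟩ := h.exists_similarity σ k
  obtain ⟨⟨T, rfl⟩, -⟩ := exists_homeomorph_of_similarity (h.prodC_pos k) hS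
  rw [hSJ]
  exact h.compact.image T.continuous

lemma isCompact_moranSet (h : IsMoranSystem J n c Jw) : IsCompact (moranSet n Jw) := by
  have h1 : moranSet n Jw = ⋂ k, ⋃ σ : ∀ i, Fin (n i), Jw (prefixWord σ k) := by
    ext x
    simp [h.mem_moranSet_iff]
  have h2 : ∀ k, IsCompact (⋃ σ : ∀ i, Fin (n i), Jw (prefixWord σ k)) := by
    intro k
    have : (Set.range fun σ : ∀ i, Fin (n i) => Jw (prefixWord σ k)).Finite := by
      have hfac : ∀ σ : ∀ i, Fin (n i), prefixWord σ k =
          List.ofFn (fun i : Fin k => (((fun i : Fin k => σ i) i : Fin (n i)) : ℕ)) := fun σ => by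
        simp [prefixWord, List.ofFn_eq_map, ← List.map_coe_finRange_eq_range]
      have h3 : (Set.range fun σ : ∀ i, Fin (n i) => Jw (prefixWord σ k)) ⊆
          Set.range fun g : ∀ i : Fin k, Fin (n i) => Jw (List.ofFn fun i => (g i : ℕ)) := by
        rintro _ ⟨σ, rfl⟩
        exact ⟨fun i => σ i, by simp only [hfac]⟩
      exact (Set.finite_range _).subset h3
    rw [← Set.sUnion_range]
    refine this.isCompact_sUnion ?_
    rintro _ ⟨σ, rfl⟩
    exact h.isCompact_piece σ k
  rw [h1]
  exact (h2 0).of_isClosed_subset (isClosed_iInter fun k => (h2 k).isClosed) (Set.iInter_subset _ 0)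

lemma moranCoding (h : IsMoranSystem J n c Jw) :
    MoranCoding (moranSet n Jw) n c (Metric.diam J) fun k σ => Jw (prefixWord σ k) where
  compact_set := h.isCompact_moranSet
  compact k σ := h.isCompact_piece σ k
  nonempty k σ := by
    obtain ⟨S, hS, hSJ⟩ := h.exists_similarity σ k
    rw [hSJ]
    exact (h.int_nonempty.mono interior_subset).image S
  anti k σ := h.subset_succ σ k
  congr k σ τ hst := by rw [prefixWord_congr σ τ hst]
  diam k σ := by
    obtain ⟨S, hS, hSJ⟩ := h.exists_similarity σ k
    rw [hSJ]
    rintro _ ⟨x, hx, rfl⟩ _ ⟨y, hy, rfl⟩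
    rw [hS]
    exact mul_le_mul_of_nonneg_left (Metric.dist_le_diam_of_mem h.compact.isBounded hx hy)
      (h.prodC_pos k).le
  code x := by
    refine ⟨fun hx => h.exists_code (h.mem_moranSet_iff.1 hx), ?_⟩
    rintro ⟨σ, hσ⟩
    exact h.mem_moranSet_iff.2 fun k => ⟨σ, hσ k⟩
  mem_of x hx := h.mem_moranSet_iff.2 hx
  pack := h.exists_pack

end IsMoranSystem

/-- Follow, from `root`, a sequence of successive children that all satisfy `Q`. -/
def branch {α : Type*} [Nonempty α] (ch : ℕ → α → Set α) (root : α) (Q : α → Prop) : ℕ → α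
  | 0 => root
  | k + 1 => Classical.epsilon fun t => t ∈ ch k (branch ch root Q k) ∧ Q t

lemma branch_spec {α : Type*} [Nonempty α] {ch : ℕ → α → Set α} {root : α} {Q : α → Prop}
    {Good : ℕ → α → Prop} (h0 : Good 0 root) (hQ0 : Q root)
    (hch : ∀ k s, Good k s → ∀ t ∈ ch k s, Good (k + 1) t)
    (hQ : ∀ k s, Good k s → Q s → ∃ t ∈ ch k s, Q t) (k : ℕ) :
    (Good k (branch ch root Q k) ∧ Q (branch ch root Q k)) ∧
      branch ch root Q (k + 1) ∈ ch k (branch ch root Q k) := by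
  have key : ∀ k, Good k (branch ch root Q k) → Q (branch ch root Q k) →
      branch ch root Q (k + 1) ∈ ch k (branch ch root Q k) ∧ Q (branch ch root Q (k + 1)) :=
    fun k h1 h2 => Classical.epsilon_spec (hQ k _ h1 h2)
  have : Good k (branch ch root Q k) ∧ Q (branch ch root Q k) := by
    induction k with
    | zero => exact ⟨h0, hQ0⟩
    | succ k ih => exact ⟨hch k _ ih.1 _ (key k ih.1 ih.2).1, (key k ih.1 ih.2).2⟩
  exact ⟨this, (key k this.1 this.2).1⟩

/-- Matching two hierarchical decompositions, one of `A` and one inside `B`, produces a map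
`A → B` that respects the scales of both. -/
lemma exists_matching {X Y : Type*} [MetricSpace X] [MetricSpace Y] {A : Set X} {B Q₀ : Set Y}
    (Good : ℕ → Set X → Set Y → Prop) {α β α' β' : ℕ → ℝ} (Cov : Prop)
    (h0 : Good 0 A Q₀)
    (hstep : ∀ k p q, Good k p q → ∃ 𝒮 : Set (Set X × Set Y),
      (∀ s ∈ 𝒮, Good (k + 1) s.1 s.2 ∧ s.1 ⊆ p ∧ s.2 ⊆ q) ∧
      (∀ x ∈ p, ∃ s ∈ 𝒮, x ∈ s.1) ∧ (Cov → ∀ y ∈ q, ∃ s ∈ 𝒮, y ∈ s.2) ∧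
      ∀ s ∈ 𝒮, ∀ t ∈ 𝒮, s ≠ t →
        (∀ x ∈ s.1, ∀ x' ∈ t.1, α k ≤ dist x x') ∧ (∀ y ∈ s.2, ∀ y' ∈ t.2, α' k ≤ dist y y'))
    (hdiam : ∀ k p q, Good k p q →
      (∀ x ∈ p, ∀ x' ∈ p, dist x x' ≤ β k) ∧ (∀ y ∈ q, ∀ y' ∈ q, dist y y' ≤ β' k))
    (hcomp : ∀ k p q, Good k p q → IsCompact q ∧ q.Nonempty)
    (hcomp' : Cov → ∀ k p q, Good k p q → IsCompact p ∧ p.Nonempty)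
    (hα : ∀ k, 0 < α k)
    (hβ : Tendsto β atTop (nhds 0)) (hβ' : Tendsto β' atTop (nhds 0))
    (hB : ∀ y, (∀ k, ∃ p q, Good k p q ∧ y ∈ q) → y ∈ B) :
    ∃ f : X → Y, Set.MapsTo f A B ∧
      (∀ x ∈ A, ∀ x' ∈ A, x ≠ x' → ∃ k, α k ≤ dist x x' ∧ dist x x' ≤ β k ∧
        α' k ≤ dist (f x) (f x') ∧ dist (f x) (f x') ≤ β' k) ∧
      (Cov → B ⊆ Q₀ → Set.SurjOn f A B) := by
  classical
  choose! ch hch using fun k (s : Set X × Set Y) (h : Good k s.1 s.2) => hstep k s.1 s.2 h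
  let G : ℕ → Set X × Set Y → Prop := fun k s => Good k s.1 s.2
  have hG : ∀ k s, G k s → ∀ t ∈ ch k s, G (k + 1) t := fun k s hs t ht => ((hch k s hs).1 t ht).1
  let b : X → ℕ → Set X × Set Y := fun x => branch ch (A, Q₀) fun s => x ∈ s.1
  let b' : Y → ℕ → Set X × Set Y := fun y => branch ch (A, Q₀) fun s => y ∈ s.2
  have hb : ∀ x ∈ A, ∀ k, (G k (b x k) ∧ x ∈ (b x k).1) ∧ b x (k + 1) ∈ ch k (b x k) :=
    fun x hx k => branch_spec (Good := G) (Q := fun s => x ∈ s.1) h0 hx hG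
      (fun k s hs hxs => (hch k s hs).2.1 x hxs) k
  have hb' : Cov → ∀ y ∈ Q₀, ∀ k,
      (G k (b' y k) ∧ y ∈ (b' y k).2) ∧ b' y (k + 1) ∈ ch k (b' y k) :=
    fun hc y hy k => branch_spec (Good := G) (Q := fun s => y ∈ s.2) h0 hy hG
      (fun k s hs hys => (hch k s hs).2.2.1 hc y hys) k
  have hne : ∀ x ∈ A, ∃ y, ∀ k, y ∈ (b x k).2 := by
    intro x hx
    obtain ⟨y, hy⟩ := IsCompact.nonempty_iInter_of_sequence_nonempty_isCompact_isClosed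
      (fun k => (b x k).2)
      (fun k => ((hch k _ (hb x hx k).1.1).1 _ (hb x hx k).2).2.2)
      (fun k => (hcomp k _ _ (hb x hx k).1.1).2) (hcomp 0 _ _ (hb x hx 0).1.1).1
      (fun k => (hcomp k _ _ (hb x hx k).1.1).1.isClosed)
    exact ⟨y, fun k => Set.mem_iInter.1 hy k⟩
  obtain ⟨y₀, -⟩ := (hcomp 0 _ _ h0).2
  have hYne : Nonempty Y := ⟨y₀⟩
  choose! f hf using hne
  refine ⟨f, fun x hx => hB _ fun k => ⟨_, _, (hb x hx k).1.1, hf x hx k⟩, ?_, ?_⟩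
  · intro x hx x' hx' hxx
    have hex : ∃ k, b x k ≠ b x' k := by
      by_contra hcon
      push Not at hcon
      have h1 : ∀ k, dist x x' ≤ β k := fun k =>
        (hdiam k _ _ (hb x hx k).1.1).1 x (hb x hx k).1.2 x' (by
          rw [hcon k]; exact (hb x' hx' k).1.2)
      have := ge_of_tendsto' hβ h1
      exact hxx (dist_le_zero.1 this)
    obtain ⟨k, hk⟩ : ∃ k, Nat.find hex = k + 1 := by
      rcases h : Nat.find hex with _ | k
      · exact absurd (show b x 0 = b x' 0 from rfl) (h ▸ Nat.find_spec hex)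
      · exact ⟨k, rfl⟩
    have hne : b x (k + 1) ≠ b x' (k + 1) := hk ▸ Nat.find_spec hex
    have heq : b x k = b x' k := not_not.1 (Nat.find_min hex (by omega))
    have hgood := (hb x hx k).1.1
    have h1 := (hb x hx k).2
    have h2 := (hb x' hx' k).2
    rw [← heq] at h2
    have h3 := (hch k _ hgood).2.2.2 _ h1 _ h2 hne
    have h4 := hdiam k _ _ hgood
    refine ⟨k, h3.1 _ (hb x hx (k + 1)).1.2 _ (hb x' hx' (k + 1)).1.2,
      h4.1 _ (hb x hx k).1.2 _ ?_, h3.2 _ (hf x hx _) _ (hf x' hx' _),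
      h4.2 _ (hf x hx k) _ ?_⟩
    · rw [heq]; exact (hb x' hx' k).1.2
    · rw [heq]; exact hf x' hx' k
  · intro hc hBQ y hy
    have hyb := hb' hc y (hBQ hy)
    obtain ⟨x, hx⟩ := IsCompact.nonempty_iInter_of_sequence_nonempty_isCompact_isClosed
      (fun k => (b' y k).1)
      (fun k => ((hch k _ (hyb k).1.1).1 _ (hyb k).2).2.1)
      (fun k => (hcomp' hc k _ _ (hyb k).1.1).2) (hcomp' hc 0 _ _ (hyb 0).1.1).1
      (fun k => (hcomp' hc k _ _ (hyb k).1.1).1.isClosed)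
    have hx : ∀ k, x ∈ (b' y k).1 := fun k => Set.mem_iInter.1 hx k
    have hxA : x ∈ A := hx 0
    have heq : ∀ k, b x k = b' y k := by
      intro k
      induction k with
      | zero => rfl
      | succ k ih =>
        by_contra hne
        have h1 := (hb x hxA k).2
        rw [ih] at h1
        have h2 := ((hch k _ (hyb k).1.1).2.2.2 _ h1 _ (hyb k).2 hne).1 x
          (hb x hxA (k + 1)).1.2 x (hx (k + 1))
        rw [dist_self] at h2
        exact absurd h2 (hα k).not_ge
    refine ⟨x, hxA, ?_⟩
    have h1 : ∀ k, dist (f x) y ≤ β' k := fun k =>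
      (hdiam k _ _ (hyb k).1.1).2 _ (by rw [← heq k]; exact hf x hxA k) _ (hyb k).1.2
    exact dist_le_zero.1 (ge_of_tendsto' hβ' h1)

/-- The word that agrees with `g` on `s` and with `σ` elsewhere. -/
def glue {n : ℕ → ℕ} (σ : ∀ i, Fin (n i)) (s : Finset ℕ) (g : ∀ i : s, Fin (n i)) :
    ∀ i, Fin (n i) :=
  fun i => if h : i ∈ s then g ⟨i, h⟩ else σ i

lemma glue_of_notMem {n : ℕ → ℕ} (σ : ∀ i, Fin (n i)) {s : Finset ℕ} (g : ∀ i : s, Fin (n i))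
    {i : ℕ} (hi : i ∉ s) : glue σ s g i = σ i := dif_neg hi

lemma eq_of_glue_eq {n : ℕ → ℕ} {σ : ∀ i, Fin (n i)} {s : Finset ℕ} {g g' : ∀ i : s, Fin (n i)}
    (h : ∀ i ∈ s, glue σ s g i = glue σ s g' i) : g = g' := by
  ext ⟨i, hi⟩
  have := h i hi
  simp only [glue, hi, dif_pos] at this
  rw [this]

lemma Set.finite_and_ncard_le {α : Type*} {V : Set α} {m : ℕ}
    (h : ∀ T : Finset α, (T : Set α) ⊆ V → T.card ≤ m) : V.Finite ∧ V.ncard ≤ m := by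
  have hfin : V.Finite := by
    by_contra hinf
    obtain ⟨T, hT, hc⟩ := Set.Infinite.exists_subset_card_eq hinf (m + 1)
    have := h T hT
    omega
  refine ⟨hfin, ?_⟩
  rw [Set.ncard_eq_toFinset_card V hfin]
  exact h _ (by simp)

namespace MoranCoding

variable {X : Type*} [MetricSpace X] {A : Set X} {n : ℕ → ℕ} {c : ℕ → ℝ} {D : ℝ}
  {P : ℕ → (∀ i, Fin (n i)) → Set X} {M : ℕ} {c₀ γ : ℝ}

lemma anti_of_le (h : MoranCoding A n c D P) (σ : ∀ i, Fin (n i)) {j k : ℕ} (hjk : j ≤ k) :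
    P k σ ⊆ P j σ :=
  antitone_nat_of_succ_le (f := fun k => P k σ) (fun k => h.anti k σ) hjk

lemma exists_point (h : MoranCoding A n c D P) (σ : ∀ i, Fin (n i)) :
    ∃ x ∈ A, ∀ k, x ∈ P k σ := by
  obtain ⟨x, hx⟩ := IsCompact.nonempty_iInter_of_sequence_nonempty_isCompact_isClosed
    (fun k => P k σ) (fun k => h.anti k σ) (fun k => h.nonempty k σ) (h.compact 0 σ)
    (fun k => (h.compact k σ).isClosed)
  have hx : ∀ k, x ∈ P k σ := fun k => Set.mem_iInter.1 hx k
  exact ⟨x, (h.code x).2 ⟨σ, hx⟩, hx⟩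

lemma dist_le (h : MoranCoding A n c D P) {x y : X} (hx : x ∈ A) (hy : y ∈ A) :
    dist x y ≤ D := by
  obtain ⟨σ, hσ⟩ := (h.code x).1 hx
  obtain ⟨τ, hτ⟩ := (h.code y).1 hy
  have := h.diam 0 σ x (hσ 0) y (by rw [h.congr 0 σ τ (by simp)]; exact hτ 0)
  simpa [prodC] using this

/-- Number of basic sets of level `j'` meeting a ball of the size of level `j`. -/
lemma exists_card_le (h : MoranCoding A n c D P) (K : ℝ) :
    ∃ N : ℕ, 0 < N ∧ ∀ j j', j ≤ j' → ∀ x (S : Finset (∀ i, Fin (n i))),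
      (∀ σ ∈ S, (P j' σ ∩ Metric.closedBall x (K * prodC c j)).Nonempty) →
      (∀ σ ∈ S, ∀ τ ∈ S, (∀ i < j', σ i = τ i) → σ = τ) →
      S.card ≤ N * ∏ i ∈ Finset.Ico j j', n i := by
  classical
  obtain ⟨N, hN⟩ := h.pack K
  refine ⟨N + 1, N.succ_pos, fun j j' hj x S hS hinj => ?_⟩
  let g : (∀ i, Fin (n i)) → ∀ i : Fin j, Fin (n i) := fun σ i => σ i
  have hfib : ∀ a ∈ S.image g, (S.filter fun σ => g σ = a).card ≤ ∏ i ∈ Finset.Ico j j', n i := by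
    intro a _
    have hcard : (Finset.univ : Finset (∀ i : Finset.Ico j j', Fin (n i))).card =
        ∏ i ∈ Finset.Ico j j', n i := by
      rw [Finset.card_univ, Fintype.card_pi]
      simp only [Fintype.card_fin]
      exact Finset.prod_coe_sort (Finset.Ico j j') n
    rw [← hcard]
    refine Finset.card_le_card_of_injOn (fun σ (i : Finset.Ico j j') => σ i)
      (fun _ _ => Finset.mem_coe.2 (Finset.mem_univ _)) ?_
    intro σ hσ τ hτ hst
    have hσ := Finset.mem_filter.1 (Finset.mem_coe.1 hσ)
    have hτ := Finset.mem_filter.1 (Finset.mem_coe.1 hτ)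
    refine hinj σ hσ.1 τ hτ.1 fun i hi => ?_
    rcases lt_or_ge i j with hij | hij
    · exact congrFun (hσ.2.trans hτ.2.symm) ⟨i, hij⟩
    · exact congrFun hst ⟨i, Finset.mem_Ico.2 ⟨hij, hi⟩⟩
  have him : (S.image g).card ≤ N := by
    obtain ⟨T, hTS, hTinj, hTim⟩ := Finset.exists_subset_injOn_image_eq_of_surjOn (f := g) S
      (S.image g) (by rw [Finset.coe_image]; exact Set.surjOn_image _ _)
    rw [← hTim, Finset.card_image_of_injOn hTinj]
    refine hN j x T (fun σ hσ => ?_) fun σ hσ τ hτ hst => ?_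
    · exact (hS σ (hTS hσ)).mono (Set.inter_subset_inter_left _ (h.anti_of_le σ hj))
    · exact hTinj hσ hτ (funext fun i => hst i i.isLt)
  calc S.card ≤ (∏ i ∈ Finset.Ico j j', n i) * (S.image g).card :=
        Finset.card_le_mul_card_image S _ hfib
    _ ≤ (∏ i ∈ Finset.Ico j j', n i) * (N + 1) := Nat.mul_le_mul_left _ (him.trans N.le_succ)
    _ = _ := mul_comm _ _

end MoranCoding

/-- `x` and `y` are joined by a chain in `A` with steps of length at most `r`. -/
def Chain {X : Type*} [MetricSpace X] (A : Set X) (r : ℝ) : X → X → Prop :=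
  Relation.ReflTransGen fun a b => a ∈ A ∧ b ∈ A ∧ dist a b ≤ r

namespace Chain

variable {X : Type*} [MetricSpace X] {A : Set X} {r : ℝ} {x y z : X}

lemma of_dist (hx : x ∈ A) (hy : y ∈ A) (h : dist x y ≤ r) : Chain A r x y :=
  .single ⟨hx, hy, h⟩

lemma symm (h : Chain A r x y) : Chain A r y x := by
  induction h with
  | refl => exact .refl
  | tail _ h ih => exact .head ⟨h.2.1, h.1, by rw [dist_comm]; exact h.2.2⟩ ih

lemma mono {r' : ℝ} (hr : r ≤ r') (h : Chain A r x y) : Chain A r' x y := by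
  induction h with
  | refl => exact .refl
  | tail _ h ih => exact .tail ih ⟨h.1, h.2.1, h.2.2.trans hr⟩

lemma mem (h : Chain A r x y) (hx : x ∈ A) : y ∈ A := by
  induction h with
  | refl => exact hx
  | tail _ h _ => exact h.2.1

lemma setOf_eq_iff : {z | Chain A r x z} = {z | Chain A r y z} ↔ Chain A r x y := by
  constructor
  · intro h
    have : y ∈ {z | Chain A r x z} := by
      rw [h]; exact Relation.ReflTransGen.refl
    exact this
  · intro h
    ext z
    exact ⟨fun hz => h.symm.trans hz, fun hz => h.trans hz⟩

lemma subset_of_gap {E : Set X} (hxE : x ∈ E)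
    (hgap : ENNReal.ofReal r < setDistE E (A \ E)) (h : Chain A r x y) : y ∈ E := by
  induction h with
  | refl => exact hxE
  | @tail a b _ h ih =>
    by_contra hb
    have h1 : setDistE E (A \ E) ≤ edist a b :=
      iInf₂_le_of_le a ih (iInf₂_le_of_le b ⟨h.2.1, hb⟩ le_rfl)
    have h2 : edist a b ≤ ENNReal.ofReal r := by
      rw [edist_dist]; exact ENNReal.ofReal_le_ofReal h.2.2
    exact absurd (hgap.trans_le (h1.trans h2)) (lt_irrefl _)

/-- Along a chain with small steps the distance to the start takes approximately all values. -/
lemma exists_dist_mem (h : Chain A r x y) {a : ℝ} (ha : 0 ≤ a)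
    (hay : a < dist x y) : ∃ z ∈ A, a < dist x z ∧ dist x z ≤ a + r := by
  induction h with
  | refl => rw [dist_self] at hay; linarith
  | @tail b y _ h ih =>
    rcases lt_or_ge a (dist x b) with hb | hb
    · exact ih hb
    · exact ⟨y, h.2.1, hay, by linarith [dist_triangle x b y, h.2.2]⟩

end Chain

/-- A bounded uniformly disconnected set has small chain components at every scale. -/
lemma UnifDisconn.exists_chain_bound {X : Type*} [MetricSpace X] {A : Set X} {D : ℝ}
    (hD : 0 < D) (hA : ∀ x ∈ A, ∀ y ∈ A, dist x y ≤ D) (h : UnifDisconn A) :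
    ∃ C : ℝ, 1 ≤ C ∧ ∀ r, 0 < r → ∀ x ∈ A, ∀ y, Chain A r x y → dist x y ≤ C * r := by
  obtain ⟨C, hC, R, hR, h⟩ := h
  refine ⟨max C (D / R), hC.le.trans (le_max_left _ _), fun r hr x hx y hxy => ?_⟩
  rcases lt_or_ge r R with hrR | hrR
  · obtain ⟨E, hEA, hball, hEC, hgap⟩ := h x hx r hr hrR
    have hxE : x ∈ E := hball ⟨hx, Metric.mem_closedBall_self hr.le⟩
    have := hEC (hxy.subset_of_gap hxE hgap)
    rw [Metric.mem_closedBall, dist_comm] at this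
    exact this.trans (mul_le_mul_of_nonneg_right (le_max_left _ _) hr.le)
  · refine (hA x hx y (hxy.mem hx)).trans ?_
    calc D = D / R * R := by field_simp
      _ ≤ max C (D / R) * r := mul_le_mul (le_max_right _ _) hrR hR.le (by positivity)

/-- A nested sequence of labellings `q j` of `A` whose classes have size comparable to `r j`,
are `r j`-separated, and branch in number comparable to the products of `n`. -/
structure ClusterTree {X : Type*} [MetricSpace X] (A : Set X) (n : ℕ → ℕ) (r : ℕ → ℝ) (N : ℕ)
    (C : ℝ) (q : ℕ → X → Set X) : Prop where
  sep : ∀ j, ∀ x ∈ A, ∀ y ∈ A, q j x ≠ q j y → r j ≤ dist x y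
  diam : ∀ j, ∀ x ∈ A, ∀ y ∈ A, q j x = q j y → dist x y ≤ C * r j
  refine : ∀ j j', j ≤ j' → ∀ x ∈ A, ∀ y ∈ A, q j' x = q j' y → q j x = q j y
  zero : ∀ x ∈ A, ∀ y ∈ A, q 0 x = q 0 y
  upper : ∀ j j', j ≤ j' → ∀ x ∈ A, ((q j') '' {y ∈ A | q j y = q j x}).Finite ∧
    ((q j') '' {y ∈ A | q j y = q j x}).ncard ≤ N * ∏ i ∈ Finset.Ico j j', n i
  lower : ∀ j j', j ≤ j' → ∀ x ∈ A,
    ∏ i ∈ Finset.Ico j j', n i ≤ N * ((q j') '' {y ∈ A | q j y = q j x}).ncard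

lemma MoranCoding.exists_clusterTree {X : Type*} [MetricSpace X] {A : Set X} {n : ℕ → ℕ}
    {c : ℕ → ℝ} {D : ℝ} {P : ℕ → (∀ i, Fin (n i)) → Set X} {M : ℕ} {c₀ γ : ℝ}
    (hd : MoranData n c D M c₀ γ) (h : MoranCoding A n c D P) (hA : UnifDisconn A) :
    ∃ (N : ℕ) (C : ℝ) (q : ℕ → X → Set X), 0 < N ∧ 1 ≤ C ∧
      ClusterTree A n (fun j => prodC c j * D) N C q := by
  classical
  obtain ⟨C, hC, hch⟩ := hA.exists_chain_bound hd.D_pos fun x hx y hy => h.dist_le hx hy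
  obtain ⟨N, hN, hcard⟩ := h.exists_card_le (C * D)
  have hr : ∀ j, 0 < prodC c j * D := fun j => mul_pos (hd.prodC_pos j) hd.D_pos
  have hsame : ∀ j σ τ x y, x ∈ A → y ∈ A → x ∈ P j σ → y ∈ P j τ → (∀ i < j, σ i = τ i) →
      Chain A (prodC c j * D) x y := fun j σ τ x y hx hy hxσ hyτ hst =>
    .of_dist hx hy (h.diam j σ x hxσ y (by rwa [h.congr j σ τ hst]))
  have hcode : ∀ x ∈ A, ∃ σ : ∀ i, Fin (n i), ∀ k, x ∈ P k σ := fun x hx => (h.code x).1 hx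
  have hΩ : Nonempty (∀ i, Fin (n i)) := ⟨fun i => ⟨0, by have := hd.two_le i; omega⟩⟩
  choose! code hcode using hcode
  choose pt hptA hpt using h.exists_point
  have hupper : ∀ j j', j ≤ j' → ∀ x ∈ A,
      ((fun x => {z | Chain A (prodC c j' * D) x z}) ''
        {y ∈ A | {z | Chain A (prodC c j * D) y z} = {z | Chain A (prodC c j * D) x z}}).Finite ∧
      ((fun x => {z | Chain A (prodC c j' * D) x z}) ''
        {y ∈ A | {z | Chain A (prodC c j * D) y z} = {z | Chain A (prodC c j * D) x z}}).ncard ≤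
        N * ∏ i ∈ Finset.Ico j j', n i := by
    intro j j' hj x hx
    refine Set.finite_and_ncard_le fun T hT => ?_
    have hTx : ∀ v ∈ T, ∃ y, y ∈ A ∧ Chain A (prodC c j * D) x y ∧
        {z | Chain A (prodC c j' * D) y z} = v := fun v hv => by
      obtain ⟨y, ⟨hyA, hy⟩, rfl⟩ := hT hv
      exact ⟨y, hyA, (Chain.setOf_eq_iff.1 hy).symm, rfl⟩
    have hXne : Nonempty X := ⟨x⟩
    choose! rep hrepA hrepC hrepv using hTx
    have hinj : ∀ v ∈ T, ∀ w ∈ T, (∀ i < j', code (rep v) i = code (rep w) i) → v = w := by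
      intro v hv w hw hvw
      rw [← hrepv v hv, ← hrepv w hw, Chain.setOf_eq_iff]
      exact hsame j' _ _ _ _ (hrepA v hv) (hrepA w hw) (hcode _ (hrepA v hv) _)
        (hcode _ (hrepA w hw) _) hvw
    have hcardT : (T.image fun v => code (rep v)).card = T.card :=
      Finset.card_image_of_injOn fun v hv w hw hvw =>
        hinj v hv w hw fun i _ => congrFun hvw i
    rw [← hcardT]
    refine hcard j j' hj x _ ?_ ?_
    · intro σ hσ
      obtain ⟨v, hv, rfl⟩ := Finset.mem_image.1 hσ
      refine ⟨rep v, hcode _ (hrepA v hv) _, ?_⟩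
      rw [Metric.mem_closedBall, dist_comm]
      have := hch _ (hr j) x hx _ (hrepC v hv)
      linarith
    · intro σ hσ τ hτ hst
      obtain ⟨v, hv, rfl⟩ := Finset.mem_image.1 hσ
      obtain ⟨w, hw, rfl⟩ := Finset.mem_image.1 hτ
      rw [hinj v hv w hw hst]
  refine ⟨N, C, fun j x => {z | Chain A (prodC c j * D) x z}, hN, hC, ?_, ?_, ?_, ?_, hupper, ?_⟩
  · intro j x hx y hy hne
    by_contra hlt
    exact hne (Chain.setOf_eq_iff.2 (.of_dist hx hy (not_le.1 hlt).le))
  · intro j x hx y hy heq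
    exact hch _ (hr j) x hx y (Chain.setOf_eq_iff.1 heq)
  · intro j j' hj x hx y hy heq
    exact Chain.setOf_eq_iff.2 ((Chain.setOf_eq_iff.1 heq).mono
      (mul_le_mul_of_nonneg_right (hd.prodC_anti hj) hd.D_pos.le))
  · intro x hx y hy
    refine Chain.setOf_eq_iff.2 (.of_dist hx hy ?_)
    simpa [prodC] using h.dist_le hx hy
  · intro j j' hj x hx
    let ext := glue (code x) (Finset.Ico j j')
    let lab := fun g => {z | Chain A (prodC c j' * D) (pt (ext g)) z}
    have hmem : ∀ g, lab g ∈ (fun x => {z | Chain A (prodC c j' * D) x z}) ''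
        {y ∈ A | {z | Chain A (prodC c j * D) y z} = {z | Chain A (prodC c j * D) x z}} := by
      intro g
      refine ⟨pt (ext g), ⟨hptA _, Chain.setOf_eq_iff.2 ?_⟩, rfl⟩
      exact hsame j _ _ _ _ (hptA _) hx (hpt _ j) (hcode x hx j) fun i hi =>
        glue_of_notMem _ _ (by simp; omega)
    have hcardG : (Finset.univ : Finset (∀ i : Finset.Ico j j', Fin (n i))).card =
        ∏ i ∈ Finset.Ico j j', n i := by
      rw [Finset.card_univ, Fintype.card_pi]
      simp only [Fintype.card_fin]
      exact Finset.prod_coe_sort (Finset.Ico j j') n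
    rw [← hcardG]
    refine (Finset.card_le_mul_card_image (f := lab) Finset.univ N ?_).trans
      (Nat.mul_le_mul_left _ ?_)
    · intro v hv
      obtain ⟨g₀, -, rfl⟩ := Finset.mem_image.1 hv
      have hinj : ∀ g g', (∀ i < j', ext g i = ext g' i) → g = g' := fun g g' hgg =>
        eq_of_glue_eq fun i hi => hgg i (Finset.mem_Ico.1 hi).2
      rw [← Finset.card_image_of_injective _ (f := ext)
        (fun g g' hgg => hinj g g' fun i _ => congrFun hgg i)]
      have := hcard j' j' le_rfl (pt (ext g₀))
        ((Finset.univ.filter fun g => lab g = lab g₀).image ext) ?_ ?_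
      · simpa using this
      · intro σ hσ
        obtain ⟨g, hg, rfl⟩ := Finset.mem_image.1 hσ
        refine ⟨pt (ext g), hpt _ _, ?_⟩
        have h1 := Chain.setOf_eq_iff.1 (Finset.mem_filter.1 hg).2
        rw [Metric.mem_closedBall]
        have := hch _ (hr j') _ (hptA _) _ h1
        linarith
      · intro σ hσ τ hτ hst
        obtain ⟨g, hg, rfl⟩ := Finset.mem_image.1 hσ
        obtain ⟨g', hg', rfl⟩ := Finset.mem_image.1 hτ
        rw [hinj g g' hst]
    · rw [← Set.ncard_coe_finset]
      refine Set.ncard_le_ncard ?_ (hupper j j' hj x hx).1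
      intro v hv
      obtain ⟨g, -, rfl⟩ := Finset.mem_image.1 (Finset.mem_coe.1 hv)
      exact hmem g

/-- A bound on the asymptotic growth ratio over blocks of length `k₀` gives a growth exponent less
than one. -/
lemma MoranData.exists_exponent {n : ℕ → ℕ} {c : ℕ → ℝ} {D : ℝ} {M : ℕ} {c₀ γ : ℝ}
    (h : MoranData n c D M c₀ γ) {k₀ : ℕ} (hk₀ : 1 ≤ k₀)
    (hlim : Filter.limsup (fun k : ℕ =>
          Real.log (∏ i ∈ Finset.Ico k (k + k₀), (n i : ℝ)) /
            (-Real.log (∏ i ∈ Finset.Ico k (k + k₀), c i))) Filter.atTop < 1) :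
    ∃ s K : ℝ, 0 ≤ s ∧ s < 1 ∧ ∀ j j', j ≤ j' →
      Real.log (prodN n j') - Real.log (prodN n j) ≤
        K + s * (Real.log (prodC c j) - Real.log (prodC c j')) := by
  have hN : ∀ k, Real.log (∏ i ∈ Finset.Ico k (k + k₀), (n i : ℝ)) =
      Real.log (prodN n (k + k₀)) - Real.log (prodN n k) := fun k => by
    rw [← h.log_prod_Ico (Nat.le_add_right k k₀), Nat.cast_prod]
  have hC : ∀ k, -Real.log (∏ i ∈ Finset.Ico k (k + k₀), c i) =
      Real.log (prodC c k) - Real.log (prodC c (k + k₀)) := fun k => by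
    have h1 : prodC c k * ∏ i ∈ Finset.Ico k (k + k₀), c i = prodC c (k + k₀) :=
      Finset.prod_range_mul_prod_Ico _ (Nat.le_add_right k k₀)
    rw [← h1, Real.log_mul (h.prodC_pos k).ne'
      (Finset.prod_pos fun i _ => h.c_pos i).ne']
    ring
  simp only [hN, hC] at hlim
  have hk₀' : (0 : ℝ) < k₀ := by exact_mod_cast hk₀
  have hγ := h.neg_log_γ_pos
  have hM := h.log_M_pos
  have hden : ∀ k, 0 < Real.log (prodC c k) - Real.log (prodC c (k + k₀)) := fun k =>
    (mul_pos hk₀' hγ).trans_le (h.log_prodC_add k k₀).1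
  have hbdd : IsBoundedUnder (· ≤ ·) atTop fun k =>
      (Real.log (prodN n (k + k₀)) - Real.log (prodN n k)) /
        (Real.log (prodC c k) - Real.log (prodC c (k + k₀))) := by
    refine isBoundedUnder_of ⟨k₀ * Real.log M / (k₀ * -Real.log γ), fun k => ?_⟩
    exact div_le_div₀ (by positivity) (h.log_prodN_add k k₀).2 (by positivity)
      (h.log_prodC_add k k₀).1
  obtain ⟨s₁, hs₁, hs₁'⟩ := exists_between hlim
  obtain ⟨k₁, hk₁⟩ := eventually_atTop.1 (eventually_lt_of_limsup_lt hs₁ hbdd)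
  set s := max s₁ 0 with hs
  have hs0 : 0 ≤ s := le_max_right _ _
  have hstep : ∀ k, k₁ ≤ k → Real.log (prodN n (k + k₀)) - Real.log (prodN n k) ≤
      s * (Real.log (prodC c k) - Real.log (prodC c (k + k₀))) := fun k hk => by
    have := (div_lt_iff₀ (hden k)).1 (hk₁ k hk)
    exact this.le.trans (mul_le_mul_of_nonneg_right (le_max_left _ _) (hden k).le)
  have htail : ∀ l j, k₁ ≤ j → Real.log (prodN n (j + l)) - Real.log (prodN n j) ≤
      k₀ * Real.log M + s * (Real.log (prodC c j) - Real.log (prodC c (j + l))) := by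
    intro l
    induction l using Nat.strong_induction_on with
    | _ l ih =>
      intro j hj
      rcases lt_or_ge l k₀ with hl | hl
      · have h1 := (h.log_prodN_add j l).2
        have h2 : (l : ℝ) * Real.log M ≤ k₀ * Real.log M :=
          mul_le_mul_of_nonneg_right (by exact_mod_cast hl.le) hM.le
        have h3 := h.log_prodC_anti (Nat.le_add_right j l)
        nlinarith
      · obtain ⟨l', rfl⟩ := Nat.exists_eq_add_of_le hl
        have h1 := ih l' (by omega) (j + k₀) (by omega)
        have h2 := hstep j hj
        rw [add_assoc] at h1
        nlinarith
  refine ⟨s, (k₁ + k₀) * Real.log M, hs0, max_lt hs₁' one_pos, fun j j' hj => ?_⟩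
  have hk₁M : 0 ≤ k₁ * Real.log M := by positivity
  have hk₀M : 0 ≤ k₀ * Real.log M := by positivity
  have hanti := h.log_prodC_anti hj
  have hnn : 0 ≤ s * (Real.log (prodC c j) - Real.log (prodC c j')) :=
    mul_nonneg hs0 (by linarith)
  have hhead : ∀ i, j ≤ i → i ≤ max j k₁ →
      Real.log (prodN n i) - Real.log (prodN n j) ≤ k₁ * Real.log M := by
    intro i hi hi'
    obtain ⟨l, rfl⟩ := Nat.exists_eq_add_of_le hi
    refine (h.log_prodN_add j l).2.trans ?_
    exact mul_le_mul_of_nonneg_right (by exact_mod_cast (by omega : l ≤ k₁)) hM.le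
  rcases le_total j' (max j k₁) with hj' | hj'
  · have := hhead j' hj hj'
    linarith
  · have h1 := hhead (max j k₁) (le_max_left _ _) le_rfl
    obtain ⟨l, hl⟩ := Nat.exists_eq_add_of_le hj'
    have h2 := htail l (max j k₁) (le_max_right _ _)
    rw [← hl] at h2
    have h3 := h.log_prodC_anti (le_max_left j k₁)
    nlinarith

/-- A Moran set whose growth exponent is less than one is uniformly disconnected. -/
lemma MoranCoding.unifDisconn {X : Type*} [MetricSpace X] {A : Set X} {n : ℕ → ℕ}
    {c : ℕ → ℝ} {D : ℝ} {P : ℕ → (∀ i, Fin (n i)) → Set X} {M : ℕ} {c₀ γ : ℝ}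
    (hd : MoranData n c D M c₀ γ) (h : MoranCoding A n c D P) {s K : ℝ} (hs0 : 0 ≤ s)
    (hs1 : s < 1)
    (hexp : ∀ j j', j ≤ j' → Real.log (prodN n j') - Real.log (prodN n j) ≤
        K + s * (Real.log (prodC c j) - Real.log (prodC c j'))) : UnifDisconn A := by
  classical
  obtain ⟨N, hN, hcard⟩ := h.exists_card_le (D / c₀)
  have hD := hd.D_pos
  have hc₀ := hd.c₀_pos
  -- the number of points in a long chain would grow linearly with `m`
  obtain ⟨m, hm2, hm⟩ : ∃ m : ℕ, 2 ≤ m ∧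
      Real.log N + K + s * (Real.log (4 * m) - Real.log c₀) < Real.log m := by
    have h1 : Tendsto (fun m : ℕ => (1 - s) * Real.log m) atTop atTop :=
      (Real.tendsto_log_atTop.comp tendsto_natCast_atTop_atTop).const_mul_atTop (by linarith)
    obtain ⟨m, hm2, hm⟩ := ((eventually_ge_atTop 2).and (h1.eventually_gt_atTop
      (Real.log N + K + s * (Real.log 4 - Real.log c₀)))).exists
    refine ⟨m, hm2, ?_⟩
    rw [Real.log_mul (by norm_num) (by positivity)]
    linarith
  have hm0 : (2 : ℝ) ≤ m := by exact_mod_cast hm2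
  refine ⟨4 * m, by linarith, D, hD, fun x hx r hr hrD =>
    ⟨{z | Chain A (2 * r) x z}, fun z hz => hz.mem hx, ?_, ?_, ?_⟩⟩
  · rintro z ⟨hz, hzr⟩
    rw [Metric.mem_closedBall, dist_comm] at hzr
    exact .of_dist hx hz (by linarith)
  · intro y hy
    by_contra hfar
    have hfar : 4 * m * r < dist x y := by
      rw [Metric.mem_closedBall, not_le, dist_comm] at hfar
      exact hfar
    have hyA : y ∈ A := hy.mem hx
    have hCD : 4 * m * r ≤ D := hfar.le.trans (h.dist_le hx hyA)
    have hz : ∀ i < m, ∃ z ∈ A, 4 * r * i < dist x z ∧ dist x z ≤ 4 * r * i + 2 * r := by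
      intro i hi
      have hi' : (i : ℝ) ≤ m := by exact_mod_cast hi.le
      exact hy.exists_dist_mem (by positivity) (lt_of_le_of_lt (by nlinarith) hfar)
    have hXne : Nonempty X := ⟨x⟩
    choose! z hzA hz1 hz2 using hz
    have hΩ : Nonempty (∀ i, Fin (n i)) := ⟨fun i => ⟨0, by have := hd.two_le i; omega⟩⟩
    have hcode : ∀ x ∈ A, ∃ σ : ∀ i, Fin (n i), ∀ k, x ∈ P k σ := fun x hx => (h.code x).1 hx
    choose! code hcode using hcode
    set j := levelOf c D (4 * m * r) with hj
    set j' := levelOf c D r with hj'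
    have hjj : j ≤ j' := hd.levelOf_anti hr (by nlinarith)
    have hjl : c₀ * (4 * m * r) ≤ prodC c j * D := hd.le_prodC_levelOf_of_le hCD
    have hju : prodC c j * D < 4 * m * r := hd.levelOf_spec (by positivity)
    have hj'l : c₀ * r ≤ prodC c j' * D := hd.le_prodC_levelOf_of_le hrD.le
    have hj'u : prodC c j' * D < r := hd.levelOf_spec hr
    have hinj : ∀ a < m, ∀ b < m, (∀ i < j', code (z a) i = code (z b) i) → a = b := by
      have key : ∀ a < m, ∀ b < m, (∀ i < j', code (z a) i = code (z b) i) → ¬ a < b := by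
        intro a ha b hb hab hlt
        have h1 := h.diam j' _ _ (hcode _ (hzA a ha) j') (z b)
          (by rw [h.congr j' _ _ hab]; exact hcode _ (hzA b hb) j')
        have h2 := hz2 a ha
        have h3 := hz1 b hb
        have h4 := dist_triangle x (z a) (z b)
        have h5 : (a : ℝ) + 1 ≤ b := by exact_mod_cast hlt
        nlinarith
      intro a ha b hb hab
      have h1 := key a ha b hb hab
      have h2 := key b hb a ha fun i hi => (hab i hi).symm
      omega
    have hcount := hcard j j' hjj x ((Finset.range m).image fun a => code (z a)) ?_ ?_
    · rw [Finset.card_image_of_injOn fun a ha b hb hab =>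
        hinj a (by simpa using ha) b (by simpa using hb) fun i _ => congrFun hab i,
        Finset.card_range] at hcount
      have hcount' : (m : ℝ) ≤ N * (∏ i ∈ Finset.Ico j j', n i : ℕ) := by exact_mod_cast hcount
      have hpos := hd.prod_Ico_pos j j'
      have hlog := Real.log_le_log (by linarith) hcount'
      rw [Real.log_mul (by positivity) (by positivity), hd.log_prod_Ico hjj] at hlog
      have h1 := hexp j j' hjj
      have h2 := Real.log_le_log (mul_pos (hd.prodC_pos j) hD) hju.le
      have h3 := Real.log_le_log (mul_pos hc₀ hr) hj'l
      rw [Real.log_mul (hd.prodC_pos j).ne' hD.ne', Real.log_mul (by positivity) hr.ne'] at h2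
      rw [Real.log_mul (hd.prodC_pos j').ne' hD.ne', Real.log_mul hc₀.ne' hr.ne'] at h3
      have h4 : s * (Real.log (prodC c j) - Real.log (prodC c j')) ≤
          s * (Real.log (4 * m) - Real.log c₀) := mul_le_mul_of_nonneg_left (by linarith) hs0
      linarith
    · intro σ hσ
      obtain ⟨a, ha, rfl⟩ := Finset.mem_image.1 hσ
      have ha : a < m := Finset.mem_range.1 ha
      refine ⟨z a, hcode _ (hzA a ha) _, ?_⟩
      rw [Metric.mem_closedBall, dist_comm]
      have h1 := hz2 a ha
      have h2 : (a : ℝ) + 1 ≤ m := by exact_mod_cast ha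
      have h3 : 4 * m * r ≤ D / c₀ * prodC c j := by
        rw [div_mul_eq_mul_div, le_div_iff₀ hc₀]
        linarith
      nlinarith
    · intro σ hσ τ hτ hst
      obtain ⟨a, ha, rfl⟩ := Finset.mem_image.1 hσ
      obtain ⟨b, hb, rfl⟩ := Finset.mem_image.1 hτ
      rw [hinj a (Finset.mem_range.1 ha) b (Finset.mem_range.1 hb) hst]
  · refine lt_of_lt_of_le ((ENNReal.ofReal_lt_ofReal_iff (by linarith)).2
      (by linarith : r < 2 * r)) ?_
    refine le_iInf₂ fun a ha => le_iInf₂ fun b hb => ?_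
    rw [edist_dist]
    refine ENNReal.ofReal_le_ofReal (not_lt.1 fun hlt => hb.2 ?_)
    exact Relation.ReflTransGen.tail ha ⟨Chain.mem ha hx, hb.1, hlt.le⟩

lemma MoranData.log_Phi_anti {n : ℕ → ℕ} {c : ℕ → ℝ} {D : ℝ} {M : ℕ} {c₀ γ : ℝ}
    (h : MoranData n c D M c₀ γ) {r r' : ℝ} (hr : 0 < r') (hrr : r' ≤ r) :
    Real.log (Phi n c D r) ≤ Real.log (Phi n c D r') :=
  h.log_prodN_mono (h.levelOf_anti hr hrr)

/-- A bound on the growth ratio of two Moran classes over distant scales gives a bound over all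
scales, up to an additive constant. -/
lemma MoranData.log_Phi_sub_le_mul {n : ℕ → ℕ} {c : ℕ → ℝ} {D : ℝ} {M : ℕ} {c₀ γ : ℝ}
    (h : MoranData n c D M c₀ γ) {n₂ : ℕ → ℕ} {c₂ : ℕ → ℝ} {D₂ : ℝ} {M₂ : ℕ} {c₀₂ γ₂ : ℝ}
    (h₂ : MoranData n₂ c₂ D₂ M₂ c₀₂ γ₂) {r₀ b : ℝ} (hr₀ : 0 < r₀) (hr₀1 : r₀ < 1) (hb : b < 1)
    (hratio : ∀ r r' : ℝ, 0 < r' → r' < r₀ * r → r < r₀ →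
      Real.log ((Phi n c D r' : ℝ) / (Phi n c D r : ℝ)) /
        Real.log ((Phi n₂ c₂ D₂ r' : ℝ) / (Phi n₂ c₂ D₂ r : ℝ)) ≤ b) (R : ℝ) :
    ∃ b' K : ℝ, 0 ≤ b' ∧ b' < 1 ∧ ∀ r r' : ℝ, 0 < r' → r' ≤ r → r ≤ R →
      Real.log (Phi n c D r') - Real.log (Phi n c D r) ≤
        b' * (Real.log (Phi n₂ c₂ D₂ r') - Real.log (Phi n₂ c₂ D₂ r)) + K := by
  obtain ⟨κ, κ', hκ, hκ', hup⟩ := h.log_Phi_sub_le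
  obtain ⟨κ₂, κ₂', hκ₂, hκ₂', hlow⟩ := h₂.le_log_Phi_sub r₀
  set T := max (-Real.log r₀) (κ₂' / κ₂) with hT
  have hT0 : 0 ≤ T := (Real.log_nonpos hr₀.le hr₀1.le |> neg_nonneg.2).trans (le_max_left _ _)
  have hb0 : 0 ≤ max b 0 := le_max_right _ _
  have hPhi : ∀ r, (0 : ℝ) < Phi n c D r := fun r => by exact_mod_cast h.prodN_pos _
  have hPhi₂ : ∀ r, (0 : ℝ) < Phi n₂ c₂ D₂ r := fun r => by exact_mod_cast h₂.prodN_pos _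
  have hsmall : ∀ r r' : ℝ, 0 < r' → r' ≤ r → r < r₀ →
      Real.log (Phi n c D r') - Real.log (Phi n c D r) ≤
        max b 0 * (Real.log (Phi n₂ c₂ D₂ r') - Real.log (Phi n₂ c₂ D₂ r)) + (κ * T + κ') := by
    intro r r' hr' hrr hr
    have hmono := h₂.log_Phi_anti hr' hrr
    have hnn : 0 ≤ max b 0 * (Real.log (Phi n₂ c₂ D₂ r') - Real.log (Phi n₂ c₂ D₂ r)) :=
      mul_nonneg hb0 (by linarith)
    rcases le_or_gt (Real.log r - Real.log r') T with hle | hlt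
    · have h1 := hup r r' hr' hrr
      have h2 : κ * (Real.log r - Real.log r') ≤ κ * T := mul_le_mul_of_nonneg_left hle hκ.le
      linarith
    · have h1 := hlow r r' hr' hrr hr.le
      have h2 : κ₂' < κ₂ * (Real.log r - Real.log r') := by
        have := (le_max_right (-Real.log r₀) (κ₂' / κ₂)).trans_lt hlt
        rw [div_lt_iff₀ hκ₂] at this
        linarith
      have hrp : 0 < r := hr'.trans_le hrr
      have h3 : r' < r₀ * r := by
        rw [← Real.log_lt_log_iff hr' (by positivity), Real.log_mul hr₀.ne' hrp.ne']
        have := (le_max_left (-Real.log r₀) (κ₂' / κ₂)).trans_lt hlt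
        linarith
      have h4 := hratio r r' hr' h3 hr
      rw [Real.log_div (hPhi r').ne' (hPhi r).ne', Real.log_div (hPhi₂ r').ne' (hPhi₂ r).ne',
        div_le_iff₀ (by linarith)] at h4
      have h5 : b * (Real.log (Phi n₂ c₂ D₂ r') - Real.log (Phi n₂ c₂ D₂ r)) ≤
          max b 0 * (Real.log (Phi n₂ c₂ D₂ r') - Real.log (Phi n₂ c₂ D₂ r)) :=
        mul_le_mul_of_nonneg_right (le_max_left _ _) (by linarith)
      have : 0 ≤ κ * T := by positivity
      linarith
  refine ⟨max b 0, (κ * T + κ') + (κ * |Real.log R - Real.log (r₀ / 2)| + κ'), hb0,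
    max_lt hb one_pos, fun r r' hr' hrr hR => ?_⟩
  have hrp : 0 < r := hr'.trans_le hrr
  have hmono := h₂.log_Phi_anti hr' hrr
  have hnn : 0 ≤ max b 0 * (Real.log (Phi n₂ c₂ D₂ r') - Real.log (Phi n₂ c₂ D₂ r)) :=
    mul_nonneg hb0 (by linarith)
  have hκT : 0 ≤ κ * T := by positivity
  have habs : 0 ≤ κ * |Real.log R - Real.log (r₀ / 2)| := by positivity
  have hlarge : ∀ t, r₀ / 2 ≤ t → t ≤ r → Real.log (Phi n c D t) - Real.log (Phi n c D r) ≤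
      κ * |Real.log R - Real.log (r₀ / 2)| + κ' := by
    intro t ht htr
    refine (hup r t (by linarith) htr).trans ?_
    have h1 := Real.log_le_log hrp hR
    have h2 := Real.log_le_log (by positivity) ht
    have h3 : Real.log r - Real.log t ≤ |Real.log R - Real.log (r₀ / 2)| :=
      le_trans (by linarith) (le_abs_self _)
    have := mul_le_mul_of_nonneg_left h3 hκ.le
    linarith
  rcases lt_or_ge r r₀ with hr | hr
  · have := hsmall r r' hr' hrr hr
    linarith
  · rcases le_or_gt (r₀ / 2) r' with hr1 | hr1
    · have := hlarge r' hr1 hrr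
      linarith
    · have h1 := hsmall (r₀ / 2) r' hr' hr1.le (by linarith)
      have h2 := hlarge (r₀ / 2) le_rfl (by linarith)
      have h3 := h₂.log_Phi_anti (r := r) (r' := r₀ / 2) (by positivity) (by linarith)
      have h4 : max b 0 * (Real.log (Phi n₂ c₂ D₂ r') - Real.log (Phi n₂ c₂ D₂ (r₀ / 2))) ≤
          max b 0 * (Real.log (Phi n₂ c₂ D₂ r') - Real.log (Phi n₂ c₂ D₂ r)) :=
        mul_le_mul_of_nonneg_left (by linarith) hb0
      linarith

/-- A relation with few related elements has a large independent set. -/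
lemma exists_independent {α : Type*} [Fintype α] {R : α → α → Prop} (hrefl : ∀ a, R a a)
    (hsymm : ∀ a b, R a b → R b a) {N : ℕ}
    (hN : ∀ (a : α) (T : Finset α), (∀ b ∈ T, R a b) → T.card ≤ N) :
    ∃ S : Finset α, (∀ a ∈ S, ∀ b ∈ S, a ≠ b → ¬ R a b) ∧ Fintype.card α ≤ N * S.card := by
  classical
  obtain ⟨S, hS, hmax⟩ := Finset.exists_max_image
    (Finset.univ.filter fun S : Finset α => ∀ a ∈ S, ∀ b ∈ S, a ≠ b → ¬ R a b) Finset.card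
    ⟨∅, by simp⟩
  have hS := (Finset.mem_filter.1 hS).2
  refine ⟨S, hS, ?_⟩
  have hcov : (Finset.univ : Finset α) ⊆ S.biUnion fun a => Finset.univ.filter (R a) := by
    intro b _
    by_contra hb
    have hb : ∀ a ∈ S, ¬ R a b := by simpa using hb
    have hbS : b ∉ S := fun h => hb b h (hrefl b)
    have := hmax (insert b S) (Finset.mem_filter.2 ⟨Finset.mem_univ _, ?_⟩)
    · rw [Finset.card_insert_of_notMem hbS] at this
      omega
    · intro a ha a' ha' hne
      rcases Finset.mem_insert.1 ha with h1 | h1 <;> rcases Finset.mem_insert.1 ha' with h2 | h2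
      · exact absurd (h1.trans h2.symm) hne
      · rw [h1]
        exact fun h => hb a' h2 (hsymm _ _ h)
      · rw [h2]
        exact hb a h1
      · exact hS a h1 a' h2 hne
  calc Fintype.card α ≤ (S.biUnion fun a => Finset.univ.filter (R a)).card :=
        Finset.card_le_card hcov
    _ ≤ S.card * N := Finset.card_biUnion_le_card_mul _ _ _ fun a _ =>
        hN a _ fun b hb => (Finset.mem_filter.1 hb).2
    _ = N * S.card := mul_comm _ _

/-- Every basic set of level `j` contains many separated basic sets of level `j'`. -/
lemma MoranCoding.exists_separated {X : Type*} [MetricSpace X] {A : Set X} {n : ℕ → ℕ}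
    {c : ℕ → ℝ} {D : ℝ} {P : ℕ → (∀ i, Fin (n i)) → Set X} {M : ℕ} {c₀ γ : ℝ}
    (hd : MoranData n c D M c₀ γ) (h : MoranCoding A n c D P) :
    ∃ N : ℕ, 0 < N ∧ ∀ σ j j', j ≤ j' → ∃ S : Finset (∀ i, Fin (n i)),
      (∀ τ ∈ S, P j' τ ⊆ P j σ) ∧
      (∀ τ ∈ S, ∀ τ' ∈ S, τ ≠ τ' → ∀ y ∈ P j' τ, ∀ y' ∈ P j' τ', prodC c j' ≤ dist y y') ∧
      ∏ i ∈ Finset.Ico j j', n i ≤ N * S.card := by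
  classical
  obtain ⟨N, hN, hcard⟩ := h.exists_card_le (D + 1)
  refine ⟨N, hN, fun σ j j' hj => ?_⟩
  let ext := glue (n := n) σ (Finset.Ico j j')
  have hinj : ∀ g g', (∀ i < j', ext g i = ext g' i) → g = g' := fun g g' hgg =>
    eq_of_glue_eq fun i hi => hgg i (Finset.mem_Ico.1 hi).2
  have hinj' : Function.Injective ext := fun g g' hgg => hinj g g' fun i _ => congrFun hgg i
  have hconf : ∀ (g : ∀ i : Finset.Ico j j', Fin (n i))
      (T : Finset (∀ i : Finset.Ico j j', Fin (n i))),
      (∀ g' ∈ T, g = g' ∨ ∃ y ∈ P j' (ext g), ∃ y' ∈ P j' (ext g'), dist y y' < prodC c j') →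
      T.card ≤ N := by
    intro g T hT
    obtain ⟨x, hx⟩ := h.nonempty j' (ext g)
    rw [← Finset.card_image_of_injective T hinj']
    have := hcard j' j' le_rfl x (T.image ext) ?_ ?_
    · simpa using this
    · intro τ hτ
      obtain ⟨g', hg', rfl⟩ := Finset.mem_image.1 hτ
      have hpos := hd.prodC_pos j'
      rcases hT g' hg' with rfl | ⟨y, hy, y', hy', hlt⟩
      · have := hd.D_pos
        exact ⟨x, hx, Metric.mem_closedBall_self (by positivity)⟩
      · refine ⟨y', hy', ?_⟩
        rw [Metric.mem_closedBall, dist_comm]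
        linarith [dist_triangle x y y', h.diam j' _ x hx y hy]
    · intro τ hτ τ' hτ' hst
      obtain ⟨g, -, rfl⟩ := Finset.mem_image.1 hτ
      obtain ⟨g', -, rfl⟩ := Finset.mem_image.1 hτ'
      rw [hinj g g' hst]
  obtain ⟨S, hS, hSc⟩ := exists_independent (α := ∀ i : Finset.Ico j j', Fin (n i))
    (R := fun g g' => g = g' ∨ ∃ y ∈ P j' (ext g), ∃ y' ∈ P j' (ext g'), dist y y' < prodC c j')
    (N := N) (fun g => .inl rfl) (by
      rintro g g' (rfl | ⟨y, hy, y', hy', hlt⟩)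
      · exact .inl rfl
      · exact .inr ⟨y', hy', y, hy, by rwa [dist_comm]⟩) hconf
  · refine ⟨S.image ext, ?_, ?_, ?_⟩
    · intro τ hτ
      obtain ⟨g, -, rfl⟩ := Finset.mem_image.1 hτ
      refine (h.anti_of_le _ hj).trans (h.congr j _ _ fun i hi => ?_).le
      exact glue_of_notMem _ _ (by simp; omega)
    · intro τ hτ τ' hτ' hne y hy y' hy'
      obtain ⟨g, hg, rfl⟩ := Finset.mem_image.1 hτ
      obtain ⟨g', hg', rfl⟩ := Finset.mem_image.1 hτ'
      by_contra hlt
      exact hS g hg g' hg' (fun h => hne (by rw [h])) (.inr ⟨y, hy, y', hy', not_le.1 hlt⟩)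
    · rw [Finset.card_image_of_injective _ hinj']
      refine le_trans (le_of_eq ?_) hSc
      rw [Fintype.card_pi]
      simp only [Fintype.card_fin]
      exact (Finset.prod_coe_sort (Finset.Ico j j') n).symm

lemma MoranData.exists_le_prodC_levelOf {n : ℕ → ℕ} {c : ℕ → ℝ} {D : ℝ} {M : ℕ} {c₀ γ : ℝ}
    (h : MoranData n c D M c₀ γ) {R : ℝ} (hR : 0 < R) :
    ∃ a : ℝ, 0 < a ∧ ∀ r, 0 < r → r ≤ R → a * r ≤ prodC c (levelOf c D r) * D := by
  have hD := h.D_pos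
  refine ⟨min c₀ (D / R), lt_min h.c₀_pos (by positivity), fun r hr hrR => ?_⟩
  rcases h.le_prodC_levelOf (r := r) with h0 | h0
  · rw [h0]
    simp only [prodC, Finset.range_zero, Finset.prod_empty, one_mul]
    calc min c₀ (D / R) * r ≤ D / R * R :=
          mul_le_mul (min_le_right _ _) hrR hr.le (by positivity)
      _ = D := by field_simp
  · exact (mul_le_mul_of_nonneg_right (min_le_left _ _) hr.le).trans h0

/-- A uniformly disconnected Moran set embeds bilipschitzly into every Moran set that branches
sufficiently more. -/
lemma MoranCoding.bilipEmbed {X Y : Type*} [MetricSpace X] [MetricSpace Y] {A : Set X} {n : ℕ → ℕ}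
    {c : ℕ → ℝ} {D : ℝ} {P : ℕ → (∀ i, Fin (n i)) → Set X} {M : ℕ} {c₀ γ : ℝ}
    (hd : MoranData n c D M c₀ γ) (h : MoranCoding A n c D P) (hA : UnifDisconn A)
    {B : Set Y} {n₂ : ℕ → ℕ} {c₂ : ℕ → ℝ} {D₂ : ℝ} {P₂ : ℕ → (∀ i, Fin (n₂ i)) → Set Y} {M₂ : ℕ}
    {c₀₂ γ₂ : ℝ} (hd₂ : MoranData n₂ c₂ D₂ M₂ c₀₂ γ₂) (h₂ : MoranCoding B n₂ c₂ D₂ P₂)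
    (hgrowth : ∀ R, ∃ b' K : ℝ, 0 ≤ b' ∧ b' < 1 ∧ ∀ r r' : ℝ, 0 < r' → r' ≤ r → r ≤ R →
      Real.log (Phi n c D r') - Real.log (Phi n c D r) ≤
        b' * (Real.log (Phi n₂ c₂ D₂ r') - Real.log (Phi n₂ c₂ D₂ r)) + K) :
    BilipEmbed A B := by
  classical
  obtain ⟨N, C, q, hN, hC, hq⟩ := h.exists_clusterTree hd hA
  obtain ⟨N₂, hN₂, hsep⟩ := h₂.exists_separated hd₂
  have hD := hd.D_pos
  have hD₂ := hd₂.D_pos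
  set R := D + D₂ with hR
  have hR0 : 0 < R := by linarith
  obtain ⟨b, K, hb0, hb1, hg⟩ := hgrowth R
  obtain ⟨κ, κ', hκ, hκ', hlow⟩ := hd₂.le_log_Phi_sub R
  obtain ⟨a, ha, hal⟩ := hd.exists_le_prodC_levelOf hR0
  obtain ⟨a₂, ha₂, hal₂⟩ := hd₂.exists_le_prodC_levelOf hR0
  obtain ⟨ρ, hρ0, hρ1, hρ⟩ : ∃ ρ : ℝ, 0 < ρ ∧ ρ < 1 ∧
      Real.log N + Real.log N₂ + K ≤ (1 - b) * (κ * -Real.log ρ - κ') := by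
    set T := max 1 (((Real.log N + Real.log N₂ + K) / (1 - b) + κ') / κ) with hT
    refine ⟨Real.exp (-T), Real.exp_pos _, ?_, ?_⟩
    · rw [Real.exp_lt_one_iff]
      have : 1 ≤ T := le_max_left _ _
      linarith
    · have h1 : ((Real.log N + Real.log N₂ + K) / (1 - b) + κ') / κ ≤ T := le_max_right _ _
      rw [div_le_iff₀ hκ] at h1
      rw [Real.log_exp, neg_neg]
      have h2 : (Real.log N + Real.log N₂ + K) / (1 - b) ≤ κ * T - κ' := by linarith
      rw [div_le_iff₀ (by linarith)] at h2
      linarith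
  set s : ℕ → ℝ := fun k => R * ρ ^ k with hs
  have hs0 : ∀ k, 0 < s k := fun k => by positivity
  have hs1 : ∀ k, s (k + 1) = ρ * s k := fun k => by simp only [hs, pow_succ]; ring
  have hsle : ∀ k, s (k + 1) ≤ s k := fun k => by rw [hs1]; nlinarith [hs0 k]
  have hsR : ∀ k, s k ≤ R := fun k => by
    have : ρ ^ k ≤ 1 := pow_le_one₀ hρ0.le hρ1.le
    simp only [hs]
    nlinarith
  have hstend : Tendsto s atTop (nhds 0) := by
    simpa using (tendsto_pow_atTop_nhds_zero_of_lt_one hρ0.le hρ1).const_mul R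
  set j : ℕ → ℕ := fun k => levelOf c D (s k) with hj
  set l : ℕ → ℕ := fun k => levelOf c₂ D₂ (s k) with hl
  have hjj : ∀ k, j k ≤ j (k + 1) := fun k => hd.levelOf_anti (hs0 _) (hsle k)
  have hll : ∀ k, l k ≤ l (k + 1) := fun k => hd₂.levelOf_anti (hs0 _) (hsle k)
  have hj0 : j 0 = 0 := MoranData.levelOf_eq_zero (by simp [hs, hR, hD₂])
  have hl0 : l 0 = 0 := MoranData.levelOf_eq_zero (by simp [hs, hR, hD])
  have hcount : ∀ k, N * (∏ i ∈ Finset.Ico (j k) (j (k + 1)), n i) * N₂ ≤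
      ∏ i ∈ Finset.Ico (l k) (l (k + 1)), n₂ i := by
    intro k
    have h1 := hg (s k) (s (k + 1)) (hs0 _) (hsle k) (hsR k)
    have h2 := hlow (s k) (s (k + 1)) (hs0 _) (hsle k) (hsR k)
    have h3 : Real.log (s k) - Real.log (s (k + 1)) = -Real.log ρ := by
      rw [hs1, Real.log_mul hρ0.ne' (hs0 k).ne']
      ring
    rw [h3] at h2
    have h4 := hd.log_prod_Ico (hjj k)
    have h5 := hd₂.log_prod_Ico (hll k)
    have hp := hd.prod_Ico_pos (j k) (j (k + 1))
    have hp₂ := hd₂.prod_Ico_pos (l k) (l (k + 1))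
    have h6 : Real.log ((N * (∏ i ∈ Finset.Ico (j k) (j (k + 1)), n i) * N₂ : ℕ) : ℝ) ≤
        Real.log ((∏ i ∈ Finset.Ico (l k) (l (k + 1)), n₂ i : ℕ) : ℝ) := by
      rw [Nat.cast_mul, Nat.cast_mul N, Real.log_mul (by positivity) (by positivity),
        Real.log_mul (by positivity) (by positivity), h4, h5]
      simp only [Phi] at h1 h2
      have h7 := mul_le_mul_of_nonneg_left h2 (by linarith : 0 ≤ 1 - b)
      simp only [hj, hl]
      linarith
    exact_mod_cast (Real.log_le_log_iff (by positivity) (by positivity)).1 h6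
  let Good : ℕ → Set X → Set Y → Prop := fun k p t =>
    (∃ x ∈ A, p = {y ∈ A | q (j k) y = q (j k) x}) ∧ ∃ σ, t = P₂ (l k) σ
  have hΩ : Nonempty (∀ i, Fin (n i)) := ⟨fun i => ⟨0, by have := hd.two_le i; omega⟩⟩
  have hΩ₂ : Nonempty (∀ i, Fin (n₂ i)) := ⟨fun i => ⟨0, by have := hd₂.two_le i; omega⟩⟩
  obtain ⟨σ₀⟩ := hΩ
  obtain ⟨σ₂⟩ := hΩ₂
  obtain ⟨x₀, hx₀, -⟩ := h.exists_point σ₀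
  obtain ⟨f, hfm, hf, -⟩ := exists_matching (A := A) (B := B) (Q₀ := P₂ 0 σ₂) Good
    (α := fun k => a * s (k + 1)) (β := fun k => C * s k)
    (α' := fun k => a₂ / D₂ * s (k + 1)) (β' := s) False
    ⟨⟨x₀, hx₀, by
      rw [hj0]
      ext y
      exact ⟨fun hy => ⟨hy, hq.zero y hy x₀ hx₀⟩, fun hy => hy.1⟩⟩, σ₂, by rw [hl0]⟩
    (by
      rintro k _ _ ⟨⟨x, hx, rfl⟩, σ, rfl⟩
      obtain ⟨hfin, hle⟩ := hq.upper (j k) (j (k + 1)) (hjj k) x hx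
      obtain ⟨S, hS1, hS2, hS3⟩ := hsep σ (l k) (l (k + 1)) (hll k)
      set V := q (j (k + 1)) '' {y ∈ A | q (j k) y = q (j k) x} with hV
      have hVS : hfin.toFinset.card ≤ S.card := by
        rw [← Set.ncard_eq_toFinset_card V hfin]
        refine hle.trans (Nat.le_of_mul_le_mul_left ?_ hN₂)
        calc _ = N * (∏ i ∈ Finset.Ico (j k) (j (k + 1)), n i) * N₂ := mul_comm _ _
          _ ≤ _ := (hcount k).trans hS3
      obtain ⟨φ⟩ := Function.Embedding.nonempty_of_card_le (α := hfin.toFinset) (β := S)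
        (by simpa using hVS)
      refine ⟨Set.range fun v : hfin.toFinset =>
        ({y ∈ A | q (j (k + 1)) y = v}, P₂ (l (k + 1)) (φ v)), ?_, ?_, fun h => h.elim, ?_⟩
      · rintro _ ⟨⟨v, hv⟩, rfl⟩
        obtain ⟨z, ⟨hzA, hz⟩, rfl⟩ := hfin.mem_toFinset.1 hv
        refine ⟨⟨⟨z, hzA, rfl⟩, _, rfl⟩, fun y hy => ⟨hy.1, ?_⟩, hS1 _ (φ _).2⟩
        exact (hq.refine _ _ (hjj k) y hy.1 z hzA hy.2).trans hz
      · intro y hy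
        exact ⟨_, ⟨⟨q (j (k + 1)) y, hfin.mem_toFinset.2 ⟨y, hy, rfl⟩⟩, rfl⟩, hy.1, rfl⟩
      · rintro _ ⟨v, rfl⟩ _ ⟨w, rfl⟩ hne
        have hvw : v ≠ w := fun h => hne (by rw [h])
        constructor
        · rintro y ⟨hyA, hy⟩ y' ⟨hyA', hy'⟩
          refine (hal _ (hs0 _) (hsR _)).trans (hq.sep _ y hyA y' hyA' ?_)
          rw [hy, hy']
          exact fun h => hvw (Subtype.ext h)
        · intro y hy y' hy'
          refine le_trans ?_ (hS2 _ (φ v).2 _ (φ w).2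
            (fun h => hvw (φ.injective (Subtype.ext h))) y hy y' hy')
          rw [div_mul_eq_mul_div, div_le_iff₀ hD₂]
          exact hal₂ _ (hs0 _) (hsR _))
    (by
      rintro k _ _ ⟨⟨x, hx, rfl⟩, σ, rfl⟩
      constructor
      · rintro y ⟨hyA, hy⟩ y' ⟨hyA', hy'⟩
        refine (hq.diam _ y hyA y' hyA' (hy.trans hy'.symm)).trans ?_
        exact mul_le_mul_of_nonneg_left (hd.levelOf_spec (hs0 k)).le (by linarith)
      · intro y hy y' hy'
        exact (h₂.diam _ σ y hy y' hy').trans (hd₂.levelOf_spec (hs0 k)).le)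
    (by
      rintro k _ _ ⟨-, σ, rfl⟩
      exact ⟨h₂.compact _ _, h₂.nonempty _ _⟩)
    (fun h => h.elim) (fun k => mul_pos ha (hs0 _)) (by simpa using hstend.const_mul C) hstend
    (by
      intro y hy
      refine h₂.mem_of y fun i => ?_
      obtain ⟨k, hk⟩ := (hstend.eventually
        (gt_mem_nhds (mul_pos (hd₂.prodC_pos i) hD₂))).exists
      obtain ⟨_, _, ⟨-, σ, rfl⟩, hyσ⟩ := hy k
      refine ⟨σ, h₂.anti_of_le σ ?_ hyσ⟩
      by_contra hlt
      have h1 := hd₂.prodC_anti (not_le.1 hlt).le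
      have h2 : prodC c₂ (l k) * D₂ < s k := hd₂.levelOf_spec (hs0 k)
      nlinarith)
  have hup : ∀ x ∈ A, ∀ x' ∈ A, x ≠ x' → dist x x' ≤ C / (a₂ / D₂ * ρ) * dist (f x) (f x') ∧
      dist (f x) (f x') ≤ 1 / (a * ρ) * dist x x' := by
    intro x hx x' hx' hne
    obtain ⟨k, h1, h2, h3, h4⟩ := hf x hx x' hx' hne
    rw [hs1] at h1 h3
    constructor
    · rw [div_mul_eq_mul_div, le_div_iff₀ (by positivity)]
      calc dist x x' * (a₂ / D₂ * ρ) ≤ C * s k * (a₂ / D₂ * ρ) :=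
            mul_le_mul_of_nonneg_right h2 (by positivity)
        _ = C * (a₂ / D₂ * (ρ * s k)) := by ring
        _ ≤ _ := mul_le_mul_of_nonneg_left h3 (by linarith)
    · rw [div_mul_eq_mul_div, le_div_iff₀ (by positivity), one_mul]
      calc dist (f x) (f x') * (a * ρ) ≤ s k * (a * ρ) :=
            mul_le_mul_of_nonneg_right h4 (by positivity)
        _ = a * (ρ * s k) := by ring
        _ ≤ _ := h1
  set L := max 1 (max (C / (a₂ / D₂ * ρ)) (1 / (a * ρ))) with hL
  have hL1 : 1 ≤ L := le_max_left _ _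
  have hL2 : C / (a₂ / D₂ * ρ) ≤ L := (le_max_left _ _).trans (le_max_right _ _)
  have hL3 : 1 / (a * ρ) ≤ L := (le_max_right _ _).trans (le_max_right _ _)
  refine ⟨f, L, hL1, hfm, fun x hx x' hx' hfx => ?_, fun x hx x' hx' => ?_⟩
  · by_contra hne
    have := (hup x hx x' hx' hne).1
    rw [hfx, dist_self, mul_zero] at this
    exact hne (dist_le_zero.1 this)
  · rcases eq_or_ne x x' with rfl | hne
    · simp
    · obtain ⟨h1, h2⟩ := hup x hx x' hx' hne
      rw [div_le_iff₀ (by linarith), mul_comm]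
      exact ⟨h1.trans (mul_le_mul_of_nonneg_right hL2 dist_nonneg),
        h2.trans (mul_le_mul_of_nonneg_right hL3 dist_nonneg)⟩

/-- `f` is Hölder continuous on `A` at small scales with every exponent less than one. -/
def AlmostLipschitzOn {X Y : Type*} [MetricSpace X] [MetricSpace Y] (f : X → Y) (A : Set X) :
    Prop :=
  ∀ ε : ℝ, 0 < ε → ε < 1 → ∃ δ : ℝ, 0 < δ ∧ ∀ x ∈ A, ∀ x' ∈ A, dist x x' < δ →
    dist (f x) (f x') ≤ dist x x' ^ (1 - ε)

lemma AlmostLipschitzOn.continuousOn {X Y : Type*} [MetricSpace X] [MetricSpace Y] {f : X → Y}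
    {A : Set X} (h : AlmostLipschitzOn f A) : ContinuousOn f A := by
  obtain ⟨δ, hδ, hf⟩ := h (1 / 2) (by norm_num) (by norm_num)
  rw [Metric.continuousOn_iff]
  intro x hx η hη
  refine ⟨min δ (η ^ 2), by positivity, fun y hy hd => ?_⟩
  refine (hf y hy x hx (hd.trans_le (min_le_left _ _))).trans_lt ?_
  rw [show (1 : ℝ) - 1 / 2 = 1 / 2 by norm_num, ← Real.sqrt_eq_rpow, Real.sqrt_lt' hη]
  exact hd.trans_le (min_le_right _ _)

/-- A quasi-Lipschitz bijection between compact sets is almost Lipschitz in both directions. -/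
lemma QuasiLipEquiv.exists_almostLipschitzOn {X Y : Type*} [MetricSpace X] [MetricSpace Y]
    {A : Set X} {B : Set Y} (hA : IsCompact A) (hne : A.Nonempty) (h : QuasiLipEquiv A B) :
    ∃ (f : X → Y) (g : Y → X), Set.SurjOn f A B ∧ Set.SurjOn g B A ∧
      AlmostLipschitzOn f A ∧ AlmostLipschitzOn g B := by
  obtain ⟨f, hf, hlog⟩ := h
  have hXne : Nonempty X := ⟨hne.some⟩
  have hfpos : ∀ x ∈ A, ∀ x' ∈ A, x ≠ x' → 0 < dist (f x) (f x') := fun x hx x' hx' hxx =>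
    dist_pos.2 fun h => hxx (hf.injOn hx hx' h)
  have hbd : ∀ ε : ℝ, 0 < ε → ∃ δ : ℝ, 0 < δ ∧ ∀ x ∈ A, ∀ x' ∈ A, x ≠ x' → dist x x' < δ →
      Real.log (dist x x') < 0 ∧
      (1 + ε) * Real.log (dist x x') ≤ Real.log (dist (f x) (f x')) ∧
      Real.log (dist (f x) (f x')) ≤ (1 - ε) * Real.log (dist x x') := by
    intro ε hε
    obtain ⟨δ, hδ, hd⟩ := hlog ε hε
    refine ⟨min δ 1, by positivity, fun x hx x' hx' hxx hlt => ?_⟩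
    have hpos := dist_pos.2 hxx
    have hneg := Real.log_neg hpos (hlt.trans_le (min_le_right _ _))
    have := abs_lt.1 (hd x hx x' hx' hpos (hlt.trans_le (min_le_left _ _)))
    refine ⟨hneg, ?_, ?_⟩
    · have h1 : Real.log (dist (f x) (f x')) / Real.log (dist x x') ≤ 1 + ε := by linarith
      rwa [div_le_iff_of_neg hneg] at h1
    · have h1 : 1 - ε ≤ Real.log (dist (f x) (f x')) / Real.log (dist x x') := by linarith
      rwa [le_div_iff_of_neg hneg] at h1
  have hfA : AlmostLipschitzOn f A := by
    intro ε hε hε1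
    obtain ⟨δ, hδ, hd⟩ := hbd ε hε
    refine ⟨δ, hδ, fun x hx x' hx' hlt => ?_⟩
    rcases eq_or_ne x x' with rfl | hxx
    · simp only [dist_self]
      exact Real.rpow_nonneg le_rfl _
    · rw [← Real.log_le_log_iff (hfpos x hx x' hx' hxx)
        (Real.rpow_pos_of_pos (dist_pos.2 hxx) _), Real.log_rpow (dist_pos.2 hxx)]
      exact (hd x hx x' hx' hxx hlt).2.2
  have hinv : ∀ δ : ℝ, 0 < δ → ∃ δ' : ℝ, 0 < δ' ∧ ∀ x ∈ A, ∀ x' ∈ A,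
      dist (f x) (f x') < δ' → dist x x' < δ := by
    intro δ hδ
    have hK : IsCompact ((A ×ˢ A) ∩ {p : X × X | δ ≤ dist p.1 p.2}) :=
      (hA.prod hA).inter_right (isClosed_le continuous_const continuous_dist)
    rcases ((A ×ˢ A) ∩ {p : X × X | δ ≤ dist p.1 p.2}).eq_empty_or_nonempty with h0 | h0
    · refine ⟨1, one_pos, fun x hx x' hx' _ => ?_⟩
      by_contra hge
      have : (x, x') ∈ (A ×ˢ A) ∩ {p : X × X | δ ≤ dist p.1 p.2} := ⟨⟨hx, hx'⟩, not_lt.1 hge⟩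
      rw [h0] at this
      exact this
    · have hc := hfA.continuousOn
      have h1 : ContinuousOn (fun p : X × X => f p.1)
          ((A ×ˢ A) ∩ {p : X × X | δ ≤ dist p.1 p.2}) :=
        hc.comp continuousOn_fst fun p hp => hp.1.1
      have h2 : ContinuousOn (fun p : X × X => f p.2)
          ((A ×ˢ A) ∩ {p : X × X | δ ≤ dist p.1 p.2}) :=
        hc.comp continuousOn_snd fun p hp => hp.1.2
      obtain ⟨⟨u, v⟩, ⟨⟨hu, hv⟩, huv⟩, hmin⟩ := hK.exists_isMinOn h0
        (f := fun p : X × X => dist (f p.1) (f p.2))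
        (continuous_dist.comp_continuousOn (h1.prodMk h2))
      refine ⟨dist (f u) (f v), hfpos u hu v hv ?_, fun x hx x' hx' hlt => ?_⟩
      · rintro rfl
        change δ ≤ dist u u at huv
        rw [dist_self] at huv
        linarith
      · by_contra hge
        have := hmin (a := (x, x')) ⟨⟨hx, hx'⟩, not_lt.1 hge⟩
        exact absurd (hlt.trans_le this) (lt_irrefl _)
  refine ⟨f, Function.invFunOn f A, hf.surjOn, ?_, hfA, ?_⟩
  · intro x hx
    refine ⟨f x, hf.mapsTo hx, ?_⟩
    exact hf.injOn.leftInvOn_invFunOn hx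
  · intro ε hε hε1
    obtain ⟨δ, hδ, hd⟩ := hbd ε hε
    obtain ⟨δ', hδ', hd'⟩ := hinv δ hδ
    refine ⟨min δ' 1, by positivity, fun y hy y' hy' hlt => ?_⟩
    obtain ⟨x, hx, rfl⟩ := hf.surjOn hy
    obtain ⟨x', hx', rfl⟩ := hf.surjOn hy'
    rw [hf.injOn.leftInvOn_invFunOn hx, hf.injOn.leftInvOn_invFunOn hx']
    rcases eq_or_ne x x' with rfl | hxx
    · simp only [dist_self]
      exact Real.rpow_nonneg le_rfl _
    · have hp := hfpos x hx x' hx' hxx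
      obtain ⟨h1, h2, -⟩ := hd x hx x' hx' hxx (hd' x hx x' hx' (hlt.trans_le (min_le_left _ _)))
      have h3 := Real.log_neg hp (hlt.trans_le (min_le_right _ _))
      rw [← Real.log_le_log_iff (dist_pos.2 hxx) (Real.rpow_pos_of_pos hp _), Real.log_rpow hp]
      have h4 := mul_le_mul_of_nonneg_left h2 (show 0 ≤ 1 - ε by linarith)
      nlinarith [mul_pos (mul_pos hε hε) (neg_pos.2 h1)]

/-- An almost Lipschitz surjection cannot increase the number of basic sets by much. -/
lemma MoranCoding.exists_Phi_le {X Y : Type*} [MetricSpace X] [MetricSpace Y] {A : Set X}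
    {n : ℕ → ℕ} {c : ℕ → ℝ} {D : ℝ} {P : ℕ → (∀ i, Fin (n i)) → Set X} {M : ℕ} {c₀ γ : ℝ}
    (hd : MoranData n c D M c₀ γ) (h : MoranCoding A n c D P)
    {B : Set Y} {n₂ : ℕ → ℕ} {c₂ : ℕ → ℝ} {D₂ : ℝ} {P₂ : ℕ → (∀ i, Fin (n₂ i)) → Set Y} {M₂ : ℕ}
    {c₀₂ γ₂ : ℝ} (hd₂ : MoranData n₂ c₂ D₂ M₂ c₀₂ γ₂) (h₂ : MoranCoding B n₂ c₂ D₂ P₂)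
    {f : X → Y} (hf : Set.SurjOn f A B) (hfA : AlmostLipschitzOn f A) :
    ∃ N : ℕ, 0 < N ∧ ∀ ε : ℝ, 0 < ε → ε < 1 → ∃ δ : ℝ, 0 < δ ∧ ∀ r, 0 < r → r < δ →
      Phi n₂ c₂ D₂ (r ^ (1 - ε)) ≤ N * Phi n c D r := by
  classical
  obtain ⟨N, hN, hcard⟩ := h₂.exists_card_le (D₂ / c₀₂)
  refine ⟨N, hN, fun ε hε hε1 => ?_⟩
  obtain ⟨δ, hδ, hfδ⟩ := hfA ε hε hε1
  have hD₂ := hd₂.D_pos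
  refine ⟨min δ (D₂ ^ (1 / (1 - ε))), by positivity, fun r hr hrδ => ?_⟩
  have hε' : 0 < 1 - ε := by linarith
  have ht0 : 0 < r ^ (1 - ε) := Real.rpow_pos_of_pos hr _
  have htD : r ^ (1 - ε) ≤ D₂ := by
    have h1 : r ≤ D₂ ^ (1 / (1 - ε)) := (hrδ.trans_le (min_le_right _ _)).le
    have h2 := Real.rpow_le_rpow hr.le h1 hε'.le
    rwa [← Real.rpow_mul hD₂.le, one_div_mul_cancel hε'.ne', Real.rpow_one] at h2
  set k := levelOf c D r with hk
  set l := levelOf c₂ D₂ (r ^ (1 - ε)) with hl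
  have hkr : prodC c k * D < r := hd.levelOf_spec hr
  have hlt : c₀₂ * r ^ (1 - ε) ≤ prodC c₂ l * D₂ := hd₂.le_prodC_levelOf_of_le htD
  have hXne : Nonempty X := by
    obtain ⟨x, -, -⟩ := h.exists_point fun i => ⟨0, by have := hd.two_le i; omega⟩
    exact ⟨x⟩
  have hΩ : Nonempty (∀ i, Fin (n i)) := ⟨fun i => ⟨0, by have := hd.two_le i; omega⟩⟩
  have hcode : ∀ x ∈ A, ∃ σ : ∀ i, Fin (n i), ∀ k, x ∈ P k σ := fun x hx => (h.code x).1 hx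
  choose! code hcode using hcode
  choose pt hptB hpt using h₂.exists_point
  have hf' : ∀ y ∈ B, ∃ x ∈ A, f x = y := fun y hy => hf hy
  choose! pre hpreA hpre using hf'
  let σ₂ : ∀ i, Fin (n₂ i) := fun i => ⟨0, by have := hd₂.two_le i; omega⟩
  let ext := glue σ₂ (Finset.range l)
  have hinj : ∀ g g', (∀ i < l, ext g i = ext g' i) → g = g' := fun g g' hgg =>
    eq_of_glue_eq fun i hi => hgg i (Finset.mem_range.1 hi)
  have hinj' : Function.Injective ext := fun g g' hgg => hinj g g' fun i _ => congrFun hgg i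
  let lab : (∀ i : Finset.range l, Fin (n₂ i)) → ∀ i : Finset.range k, Fin (n i) :=
    fun g i => code (pre (pt (ext g))) i
  have hcardl : Fintype.card (∀ i : Finset.range l, Fin (n₂ i)) = prodN n₂ l := by
    rw [Fintype.card_pi]
    simp only [Fintype.card_fin]
    exact Finset.prod_coe_sort (Finset.range l) n₂
  have hcardk : Fintype.card (∀ i : Finset.range k, Fin (n i)) = prodN n k := by
    rw [Fintype.card_pi]
    simp only [Fintype.card_fin]
    exact Finset.prod_coe_sort (Finset.range k) n
  have hclose : ∀ g g', lab g = lab g' → dist (pt (ext g)) (pt (ext g')) ≤ r ^ (1 - ε) := by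
    intro g g' hgg
    have hA := hpreA _ (hptB (ext g))
    have hA' := hpreA _ (hptB (ext g'))
    have h1 : dist (pre (pt (ext g))) (pre (pt (ext g'))) < r := by
      refine (h.diam k _ _ (hcode _ hA k) _ ?_).trans_lt hkr
      rw [h.congr k _ _ fun i hi => congrFun hgg ⟨i, Finset.mem_range.2 hi⟩]
      exact hcode _ hA' k
    have h2 := hfδ _ hA _ hA' (h1.trans (hrδ.trans_le (min_le_left _ _)))
    rw [hpre _ (hptB _), hpre _ (hptB _)] at h2
    exact h2.trans (Real.rpow_le_rpow dist_nonneg h1.le hε'.le)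
  change prodN n₂ l ≤ N * prodN n k
  rw [← hcardl, ← hcardk, ← Finset.card_univ]
  refine (Finset.card_le_mul_card_image (f := lab) Finset.univ N fun v hv => ?_).trans
    (Nat.mul_le_mul_left _ (Finset.card_le_univ _))
  obtain ⟨g₀, -, rfl⟩ := Finset.mem_image.1 hv
  rw [← Finset.card_image_of_injective _ hinj']
  have := hcard l l le_rfl (pt (ext g₀))
    ((Finset.univ.filter fun g => lab g = lab g₀).image ext) ?_ ?_
  · simpa using this
  · intro σ hσ
    obtain ⟨g, hg, rfl⟩ := Finset.mem_image.1 hσ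
    refine ⟨pt (ext g), hpt _ _, ?_⟩
    rw [Metric.mem_closedBall]
    refine (hclose _ _ (Finset.mem_filter.1 hg).2).trans ?_
    rw [div_mul_eq_mul_div, le_div_iff₀ hd₂.c₀_pos]
    linarith
  · intro σ hσ τ hτ hst
    obtain ⟨g, -, rfl⟩ := Finset.mem_image.1 hσ
    obtain ⟨g', -, rfl⟩ := Finset.mem_image.1 hτ
    rw [hinj g g' hst]

lemma MoranData.tendsto_log_Phi {n : ℕ → ℕ} {c : ℕ → ℝ} {D : ℝ} {M : ℕ} {c₀ γ : ℝ}
    (h : MoranData n c D M c₀ γ) :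
    Tendsto (fun r => Real.log (Phi n c D r)) (nhdsWithin 0 (Set.Ioi 0)) atTop := by
  obtain ⟨κ, κ', hκ, -, hlow⟩ := h.le_log_Phi_sub 1
  have h1 : Tendsto (fun r => κ * -Real.log r - κ' + Real.log (Phi n c D 1))
      (nhdsWithin 0 (Set.Ioi 0)) atTop := by
    refine tendsto_atTop_add_const_right _ _ (tendsto_atTop_add_const_right _ (-κ') ?_)
    exact (tendsto_neg_atBot_atTop.comp Real.tendsto_log_nhdsGT_zero).const_mul_atTop hκ
  refine tendsto_atTop_mono' _ ?_ h1
  filter_upwards [Ioc_mem_nhdsGT (zero_lt_one' ℝ)] with r hr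
  have := hlow 1 r hr.1 hr.2 le_rfl
  rw [Real.log_one] at this
  linarith

/-- Comparability of `Phi` at almost equal scales bounds the logarithmic ratio. -/
lemma MoranData.eventually_log_Phi_le {n : ℕ → ℕ} {c : ℕ → ℝ} {D : ℝ} {M : ℕ} {c₀ γ : ℝ}
    (h : MoranData n c D M c₀ γ) {n₂ : ℕ → ℕ} {c₂ : ℕ → ℝ} {D₂ : ℝ} {M₂ : ℕ} {c₀₂ γ₂ : ℝ}
    (h₂ : MoranData n₂ c₂ D₂ M₂ c₀₂ γ₂) {N : ℕ} (hN : 0 < N)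
    (hPhi : ∀ ε : ℝ, 0 < ε → ε < 1 → ∃ δ : ℝ, 0 < δ ∧ ∀ r, 0 < r → r < δ →
      Phi n₂ c₂ D₂ (r ^ (1 - ε)) ≤ N * Phi n c D r) {η : ℝ} (hη : 0 < η) :
    ∀ᶠ r in nhdsWithin (0 : ℝ) (Set.Ioi 0),
      Real.log (Phi n₂ c₂ D₂ r) ≤ (1 + η) * Real.log (Phi n c D r) := by
  obtain ⟨κ, κ', hκ, hκ', hlow⟩ := h.le_log_Phi_sub 1
  obtain ⟨κ₂, κ₂', hκ₂, hκ₂', hup⟩ := h₂.log_Phi_sub_le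
  set ε := min (1 / 2) (η / 2 * κ / κ₂) with hε
  have hε0 : 0 < ε := by positivity
  have hε1 : ε < 1 := (min_le_left _ _).trans_lt (by norm_num)
  have hεκ : ε * κ₂ ≤ η / 2 * κ := (le_div_iff₀ hκ₂).1 (min_le_right _ _)
  obtain ⟨δ, hδ, hle⟩ := hPhi ε hε0 hε1
  filter_upwards [Ioo_mem_nhdsGT (lt_min hδ one_pos),
    h.tendsto_log_Phi.eventually_ge_atTop ((Real.log N + κ₂' + η / 2 * κ') / (η / 2))]
    with r hr hlarge
  obtain ⟨hr0, hr1⟩ := hr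
  have hrδ := hr1.trans_le (min_le_left _ _)
  have hr1 := hr1.trans_le (min_le_right _ _)
  have ht : 0 < r ^ (1 - ε) := Real.rpow_pos_of_pos hr0 _
  have hrt : r ≤ r ^ (1 - ε) := by
    conv_lhs => rw [← Real.rpow_one r]
    exact Real.rpow_le_rpow_of_exponent_ge hr0 hr1.le (by linarith)
  have h1 := hup (r ^ (1 - ε)) r hr0 hrt
  rw [Real.log_rpow hr0] at h1
  have h2 : Real.log (Phi n₂ c₂ D₂ (r ^ (1 - ε))) ≤ Real.log N + Real.log (Phi n c D r) := by
    have hp : (0 : ℝ) < Phi n c D r := by exact_mod_cast h.prodN_pos _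
    have hp₂ : (0 : ℝ) < Phi n₂ c₂ D₂ (r ^ (1 - ε)) := by exact_mod_cast h₂.prodN_pos _
    rw [← Real.log_mul (by positivity) hp.ne']
    exact Real.log_le_log hp₂ (by exact_mod_cast hle r hr0 hrδ)
  have h3 := hlow 1 r hr0 hr1.le le_rfl
  rw [Real.log_one] at h3
  have h4 : 0 ≤ Real.log (Phi n c D 1) := Real.log_natCast_nonneg _
  have h5 : Real.log r ≤ 0 := Real.log_nonpos hr0.le hr1.le
  have h6 : ε * κ₂ * -Real.log r ≤ η / 2 * κ * -Real.log r :=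
    mul_le_mul_of_nonneg_right hεκ (by linarith)
  have h7 : η / 2 * (κ * -Real.log r) ≤ η / 2 * (Real.log (Phi n c D r) + κ') :=
    mul_le_mul_of_nonneg_left (by linarith) (by positivity)
  rw [div_le_iff₀ (by positivity)] at hlarge
  nlinarith

lemma tendsto_div_of_eventually_le {ι : Type*} {l : Filter ι} {u v : ι → ℝ}
    (hu : ∀ᶠ i in l, 0 < u i) (hv : ∀ᶠ i in l, 0 < v i)
    (huv : ∀ η : ℝ, 0 < η → ∀ᶠ i in l, u i ≤ (1 + η) * v i)
    (hvu : ∀ η : ℝ, 0 < η → ∀ᶠ i in l, v i ≤ (1 + η) * u i) :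
    Tendsto (fun i => u i / v i) l (nhds 1) := by
  rw [Metric.tendsto_nhds]
  intro ε hε
  filter_upwards [hu, hv, huv (ε / 2) (by positivity), hvu (ε / 2) (by positivity)]
    with i h1 h2 h3 h4
  rw [Real.dist_eq, abs_lt]
  constructor
  · rw [lt_sub_iff_add_lt, lt_div_iff₀ h2]
    nlinarith
  · rw [sub_lt_iff_lt_add, div_lt_iff₀ h2]
    nlinarith

/-- Quasi-Lipschitz equivalent Moran sets have asymptotic growth ratio one. -/
lemma MoranCoding.tendsto_of_quasiLipEquiv {X Y : Type*} [MetricSpace X] [MetricSpace Y]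
    {A : Set X}
    {n : ℕ → ℕ} {c : ℕ → ℝ} {D : ℝ} {P : ℕ → (∀ i, Fin (n i)) → Set X} {M : ℕ} {c₀ γ : ℝ}
    (hd : MoranData n c D M c₀ γ) (h : MoranCoding A n c D P)
    {B : Set Y} {n₂ : ℕ → ℕ} {c₂ : ℕ → ℝ} {D₂ : ℝ} {P₂ : ℕ → (∀ i, Fin (n₂ i)) → Set Y} {M₂ : ℕ}
    {c₀₂ γ₂ : ℝ} (hd₂ : MoranData n₂ c₂ D₂ M₂ c₀₂ γ₂) (h₂ : MoranCoding B n₂ c₂ D₂ P₂)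
    (hq : QuasiLipEquiv A B) :
    Tendsto (fun r : ℝ => Real.log (Phi n c D r : ℝ) / Real.log (Phi n₂ c₂ D₂ r : ℝ))
      (nhdsWithin (0 : ℝ) (Set.Ioi 0)) (nhds 1) := by
  obtain ⟨x, hx, -⟩ := h.exists_point fun i => ⟨0, by have := hd.two_le i; omega⟩
  obtain ⟨f, g, hf, hg, hfA, hgB⟩ := hq.exists_almostLipschitzOn h.compact_set ⟨x, hx⟩
  obtain ⟨N, hN, hPhi⟩ := h.exists_Phi_le hd hd₂ h₂ hf hfA
  obtain ⟨N', hN', hPhi'⟩ := h₂.exists_Phi_le hd₂ hd h hg hgB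
  exact tendsto_div_of_eventually_le (hd.tendsto_log_Phi.eventually_gt_atTop 0)
    (hd₂.tendsto_log_Phi.eventually_gt_atTop 0)
    (fun η hη => hd₂.eventually_log_Phi_le hd hN' hPhi' hη)
    (fun η hη => hd.eventually_log_Phi_le hd₂ hN hPhi hη)

/-- The first level at which the logarithm of the number of basic sets reaches `u`. -/
def growthLevel (n : ℕ → ℕ) (u : ℝ) : ℕ := sInf {j : ℕ | u ≤ Real.log (prodN n j)}

/-- Minus the logarithm of the size of the basic sets of level `growthLevel n u`. -/
def logScale (n : ℕ → ℕ) (c : ℕ → ℝ) (D u : ℝ) : ℝ := -Real.log (prodC c (growthLevel n u) * D)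

lemma growthLevel_zero (n : ℕ → ℕ) : growthLevel n 0 = 0 := by
  have : growthLevel n 0 ≤ 0 := Nat.sInf_le (Real.log_natCast_nonneg _)
  omega

namespace MoranData
variable {n : ℕ → ℕ} {c : ℕ → ℝ} {D : ℝ} {M : ℕ} {c₀ γ : ℝ}

lemma le_log_prodN_growthLevel (h : MoranData n c D M c₀ γ) (u : ℝ) :
    u ≤ Real.log (prodN n (growthLevel n u)) := by
  have h1 : Tendsto (fun j : ℕ => (j : ℝ) * Real.log 2) atTop atTop :=
    tendsto_natCast_atTop_atTop.atTop_mul_const (Real.log_pos (by norm_num))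
  obtain ⟨j, hj⟩ := (h1.eventually_ge_atTop u).exists
  have hne : {j : ℕ | u ≤ Real.log (prodN n j)}.Nonempty := by
    refine ⟨j, hj.trans ?_⟩
    have := (h.log_prodN_add 0 j).1
    simpa [prodN] using this
  exact Nat.sInf_mem hne

lemma log_prodN_growthLevel_le (h : MoranData n c D M c₀ γ) {u : ℝ} (hu : 0 ≤ u) :
    Real.log (prodN n (growthLevel n u)) ≤ u + Real.log M := by
  have hM := h.log_M_pos
  rcases Nat.eq_zero_or_pos (growthLevel n u) with h0 | h0
  · rw [h0]
    simp only [prodN, Finset.range_zero, Finset.prod_empty, Nat.cast_one, Real.log_one]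
    linarith
  obtain ⟨j, hj⟩ : ∃ j, growthLevel n u = j + 1 := ⟨_, (Nat.succ_pred_eq_of_pos h0).symm⟩
  have h1 : ¬ u ≤ Real.log (prodN n j) := fun hle => by
    have : growthLevel n u ≤ j := Nat.sInf_le hle
    omega
  have h2 := (h.log_prodN_add j 1).2
  rw [hj]
  push_cast at h2
  linarith

lemma growthLevel_mono (h : MoranData n c D M c₀ γ) {u w : ℝ} (huw : u ≤ w) :
    growthLevel n u ≤ growthLevel n w :=
  Nat.sInf_le (huw.trans (h.le_log_prodN_growthLevel w))

lemma logScale_mono (h : MoranData n c D M c₀ γ) {u w : ℝ} (huw : u ≤ w) :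
    logScale n c D u ≤ logScale n c D w := by
  have h1 := h.log_prodC_anti (h.growthLevel_mono huw)
  rw [logScale, logScale, Real.log_mul (h.prodC_pos _).ne' h.D_pos.ne',
    Real.log_mul (h.prodC_pos _).ne' h.D_pos.ne']
  linarith

lemma exists_logScale_sub_le (h : MoranData n c D M c₀ γ) :
    ∃ κ κ' : ℝ, 0 < κ ∧ 0 < κ' ∧ ∀ u w : ℝ, 0 ≤ u → u ≤ w →
      logScale n c D w - logScale n c D u ≤ κ * (w - u) + κ' := by
  have hc := h.neg_log_c₀_pos
  have hM := h.log_M_pos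
  have h2 : 0 < Real.log 2 := Real.log_pos (by norm_num)
  refine ⟨-Real.log c₀ / Real.log 2, -Real.log c₀ / Real.log 2 * Real.log M, by positivity,
    by positivity, fun u w hu huw => ?_⟩
  obtain ⟨l, hl⟩ := Nat.exists_eq_add_of_le (h.growthLevel_mono huw)
  have h3 := h.log_prodN_growthLevel_le (hu.trans huw)
  have h4 := h.le_log_prodN_growthLevel u
  rw [logScale, logScale, Real.log_mul (h.prodC_pos _).ne' h.D_pos.ne',
    Real.log_mul (h.prodC_pos _).ne' h.D_pos.ne']
  rw [hl] at h3 ⊢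
  have h5 := (h.log_prodN_add (growthLevel n u) l).1
  have h6 := (h.log_prodC_add (growthLevel n u) l).2
  have h7 : (l : ℝ) ≤ (w - u + Real.log M) / Real.log 2 := by
    rw [le_div_iff₀ h2]
    linarith
  have h8 := mul_le_mul_of_nonneg_right h7 hc.le
  have h9 : -Real.log c₀ / Real.log 2 * (w - u) + -Real.log c₀ / Real.log 2 * Real.log M =
      (w - u + Real.log M) / Real.log 2 * -Real.log c₀ := by ring
  linarith

lemma exists_le_logScale (h : MoranData n c D M c₀ γ) :
    ∃ a b : ℝ, 0 < a ∧ ∀ u : ℝ, a * u - b ≤ logScale n c D u := by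
  have hγ := h.neg_log_γ_pos
  have hM := h.log_M_pos
  refine ⟨-Real.log γ / Real.log M, Real.log D, by positivity, fun u => ?_⟩
  rw [logScale, Real.log_mul (h.prodC_pos _).ne' h.D_pos.ne']
  have h4 := h.le_log_prodN_growthLevel u
  have h5 := (h.log_prodN_add 0 (growthLevel n u)).2
  have h6 := (h.log_prodC_add 0 (growthLevel n u)).1
  simp only [zero_add, prodN, prodC, Finset.range_zero, Finset.prod_empty, Nat.cast_one,
    Real.log_one, sub_zero, zero_sub] at h4 h5 h6 ⊢
  have h7 : u / Real.log M ≤ growthLevel n u := by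
    rw [div_le_iff₀ hM]
    exact h4.trans h5
  have h8 := mul_le_mul_of_nonneg_right h7 hγ.le
  have h9 : -Real.log γ / Real.log M * u = u / Real.log M * -Real.log γ := by ring
  linarith

lemma levelOf_prodC_mul (h : MoranData n c D M c₀ γ) (j : ℕ) :
    levelOf c D (prodC c j * D) = j + 1 := by
  refine le_antisymm (Nat.sInf_le ?_) ?_
  · change prodC c (j + 1) * D < prodC c j * D
    refine mul_lt_mul_of_pos_right ?_ h.D_pos
    have h1 := (h.log_prodC_add j 1).1
    have h2 := h.neg_log_γ_pos
    rw [← Real.log_lt_log_iff (h.prodC_pos _) (h.prodC_pos _)]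
    push_cast at h1
    linarith
  · by_contra hlt
    have h1 := h.levelOf_spec (mul_pos (h.prodC_pos j) h.D_pos)
    have h2 := h.prodC_anti (show levelOf c D (prodC c j * D) ≤ j by omega)
    exact absurd (h1.trans_le (mul_le_mul_of_nonneg_right h2 h.D_pos.le)) (lt_irrefl _)

lemma log_Phi_exp_neg_logScale (h : MoranData n c D M c₀ γ) {u : ℝ} (hu : 0 ≤ u) :
    u ≤ Real.log (Phi n c D (Real.exp (-logScale n c D u))) ∧
      Real.log (Phi n c D (Real.exp (-logScale n c D u))) ≤ u + 2 * Real.log M := by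
  rw [logScale, neg_neg, Real.exp_log (mul_pos (h.prodC_pos _) h.D_pos), Phi,
    h.levelOf_prodC_mul]
  have h1 := h.log_prodN_add (growthLevel n u) 1
  have h2 := h.le_log_prodN_growthLevel u
  have h3 := h.log_prodN_growthLevel_le hu
  have h4 : 0 < Real.log 2 := Real.log_pos (by norm_num)
  push_cast at h1
  constructor <;> linarith [h1.1, h1.2]

lemma tendsto_logScale (h : MoranData n c D M c₀ γ) : Tendsto (logScale n c D) atTop atTop := by
  obtain ⟨a, b, ha, hab⟩ := h.exists_le_logScale
  refine tendsto_atTop_mono hab ?_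
  exact tendsto_atTop_add_const_right _ (-b) (tendsto_id.const_mul_atTop ha)

/-- If the logarithms of the growth functions are asymptotic, then so are the scales at which a
given growth is attained. -/
lemma eventually_abs_logScale_sub_le (h : MoranData n c D M c₀ γ) {n₂ : ℕ → ℕ} {c₂ : ℕ → ℝ}
    {D₂ : ℝ} {M₂ : ℕ} {c₀₂ γ₂ : ℝ} (h₂ : MoranData n₂ c₂ D₂ M₂ c₀₂ γ₂)
    (hlim : Tendsto (fun r : ℝ => Real.log (Phi n c D r : ℝ) / Real.log (Phi n₂ c₂ D₂ r : ℝ))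
      (nhdsWithin (0 : ℝ) (Set.Ioi 0)) (nhds 1)) {η : ℝ} (hη : 0 < η) :
    ∀ᶠ u in atTop, |logScale n c D u - logScale n₂ c₂ D₂ u| ≤ η * u := by
  obtain ⟨κ, κ', hκ, hκ', hlow⟩ := h₂.le_log_Phi_sub (D + D₂)
  have hM := h.log_M_pos
  have hM₂ := h₂.log_M_pos
  have hD := h.D_pos
  have hD₂ := h₂.D_pos
  have hlim' := hlim.inv₀ one_ne_zero
  simp only [inv_div, inv_one] at hlim'
  have hθ : 0 < η * κ / 2 := by positivity
  have h1 : Tendsto (fun u => Real.exp (-logScale n c D u)) atTop (nhdsWithin 0 (Set.Ioi 0)) := by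
    refine tendsto_nhdsWithin_iff.2 ⟨?_, Eventually.of_forall fun u => Real.exp_pos _⟩
    exact Real.tendsto_exp_atBot.comp (tendsto_neg_atTop_atBot.comp h.tendsto_logScale)
  set T := κ' + 2 * Real.log M + 2 * Real.log M₂ + η * κ / 2 * (2 * Real.log M) with hT
  have hle : ∀ {n : ℕ → ℕ} {c : ℕ → ℝ} {D : ℝ} {M : ℕ} {c₀ γ : ℝ} (u : ℝ),
      MoranData n c D M c₀ γ → Real.exp (-logScale n c D u) ≤ D := by
    intro n c D M c₀ γ u h
    rw [logScale, neg_neg, Real.exp_log (mul_pos (h.prodC_pos _) h.D_pos)]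
    have h3 := h.prodC_anti (Nat.zero_le (growthLevel n u))
    have h4 : prodC c 0 = 1 := by simp [prodC]
    rw [h4] at h3
    nlinarith [h.D_pos]
  filter_upwards [h1.eventually (Metric.tendsto_nhds.1 hlim' _ hθ), eventually_gt_atTop 0,
    eventually_ge_atTop (T / (η * κ / 2))] with u hu hu0 huT
  rw [div_le_iff₀ hθ] at huT
  obtain ⟨h3, h4⟩ := h.log_Phi_exp_neg_logScale hu0.le
  obtain ⟨h5, h6⟩ := h₂.log_Phi_exp_neg_logScale hu0.le
  have hr := hle u h
  have hr₂ := hle u h₂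
  have hr0 := Real.exp_pos (-logScale n c D u)
  have hr₂0 := Real.exp_pos (-logScale n₂ c₂ D₂ u)
  have hlr := Real.log_exp (-logScale n c D u)
  have hlr₂ := Real.log_exp (-logScale n₂ c₂ D₂ u)
  set ρ := Real.exp (-logScale n c D u)
  set ρ₂ := Real.exp (-logScale n₂ c₂ D₂ u)
  have hpos : 0 < Real.log (Phi n c D ρ) := hu0.trans_le h3
  rw [Real.dist_eq, abs_lt, lt_sub_iff_add_lt, sub_lt_iff_lt_add, lt_div_iff₀ hpos,
    div_lt_iff₀ hpos] at hu
  have h7 : η * κ / 2 * Real.log (Phi n c D ρ) ≤ η * κ / 2 * (u + 2 * Real.log M) :=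
    mul_le_mul_of_nonneg_left h4 hθ.le
  obtain ⟨h8, h9⟩ := hu
  have hkey : κ * |logScale n c D u - logScale n₂ c₂ D₂ u| ≤ κ * (η * u) := by
    rcases le_total ρ ρ₂ with hle' | hle'
    · have h10 := hlow ρ₂ ρ hr0 hle' (by linarith)
      have h11 := Real.log_le_log hr0 hle'
      rw [abs_of_nonneg (by linarith)]
      rw [hlr, hlr₂] at h10
      nlinarith
    · have h10 := hlow ρ ρ₂ hr₂0 hle' (by linarith)
      have h11 := Real.log_le_log hr₂0 hle'
      rw [abs_of_nonpos (by linarith)]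
      rw [hlr, hlr₂] at h10
      nlinarith
  exact le_of_mul_le_mul_left hkey hκ

end MoranData

/-- Fine labels can be merged into exactly `K` colours without mixing coarse labels. -/
lemma exists_coloring {α ι κ : Type*} {p : Set α} (hp : p.Nonempty) {u : α → ι} {v : α → κ}
    (hvu : ∀ x ∈ p, ∀ y ∈ p, v x = v y → u x = u y) (hfin : (v '' p).Finite)
    (hufin : (u '' p).Finite) {K : ℕ} (hu : (u '' p).ncard ≤ K) (hv : K ≤ (v '' p).ncard) :
    ∃ φ : α → Fin K, (∀ i, ∃ x ∈ p, φ x = i) ∧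
      (∀ x ∈ p, ∀ y ∈ p, v x = v y → φ x = φ y) ∧
      ∀ x ∈ p, ∀ y ∈ p, φ x = φ y → u x = u y := by
  classical
  obtain ⟨x₀, hx₀⟩ := hp
  have hα : Nonempty α := ⟨x₀⟩
  have hsec : ∀ w ∈ u '' p, ∃ x ∈ p, u x = w := fun w hw => hw
  choose! g hgp hgu using hsec
  have hS₀ : (fun w => v (g w)) '' (u '' p) ⊆ v '' p := by
    rintro _ ⟨w, hw, rfl⟩
    exact ⟨g w, hgp w hw, rfl⟩
  obtain ⟨S, hS1, hS2, hS3⟩ := Set.exists_subsuperset_card_eq hS₀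
    ((Set.ncard_image_le hufin).trans hu) hv
  have hSfin : Finite S := (hfin.subset hS2).to_subtype
  have hK : 0 < K := by
    rw [← hS3, Set.ncard_pos (hfin.subset hS2)]
    exact ⟨_, hS1 ⟨u x₀, ⟨x₀, hx₀, rfl⟩, rfl⟩⟩
  have hKne : Nonempty (Fin K) := ⟨⟨0, hK⟩⟩
  let e : S ≃ Fin K := Finite.equivFinOfCardEq (by rw [Nat.card_coe_set_eq, hS3])
  let ψ : α → κ := fun x => if v x ∈ S then v x else v (g (u x))
  have hψ : ∀ x ∈ p, ψ x ∈ S ∧ ∃ z ∈ p, u z = u x ∧ ψ x = v z := by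
    intro x hx
    have hux : u x ∈ u '' p := ⟨x, hx, rfl⟩
    by_cases hvx : v x ∈ S
    · simp only [ψ, if_pos hvx]
      exact ⟨hvx, x, hx, rfl, rfl⟩
    · simp only [ψ, if_neg hvx]
      exact ⟨hS1 ⟨u x, hux, rfl⟩, g (u x), hgp _ hux, hgu _ hux, rfl⟩
  have hφ : ∀ x ∈ p, ∃ i : Fin K, (e.symm i : κ) = ψ x := fun x hx =>
    ⟨e ⟨ψ x, (hψ x hx).1⟩, by simp⟩
  choose! φ hφ using hφ
  refine ⟨φ, fun i => ?_, fun x hx y hy hxy => ?_, fun x hx y hy hxy => ?_⟩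
  · obtain ⟨x, hx, hvx⟩ := hS2 (e.symm i).2
    refine ⟨x, hx, e.symm.injective (Subtype.ext ?_)⟩
    have hmem : v x ∈ S := by
      rw [hvx]
      exact (e.symm i).2
    rw [hφ x hx]
    simp only [ψ, if_pos hmem]
    exact hvx
  · refine e.symm.injective (Subtype.ext ?_)
    rw [hφ x hx, hφ y hy]
    simp only [ψ, hxy, hvu x hx y hy hxy]
  · obtain ⟨-, z, hz, hzx, hψx⟩ := hψ x hx
    obtain ⟨-, w, hw, hwy, hψy⟩ := hψ y hy
    rw [← hzx, ← hwy]
    refine hvu z hz w hw ?_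
    rw [← hψx, ← hψy, ← hφ x hx, ← hφ y hy, hxy]

/-- A union of clusters of level `t` contained in a single cluster of level `s`. -/
structure IsPiece {X : Type*} (A : Set X) (q : ℕ → X → Set X) (s t : ℕ) (p : Set X) : Prop where
  subset : p ⊆ A
  nonempty : p.Nonempty
  saturated : ∀ x ∈ p, ∀ y ∈ A, q t x = q t y → y ∈ p
  eq_of_mem : ∀ x ∈ p, ∀ y ∈ p, q s x = q s y

namespace ClusterTree
variable {X : Type*} [MetricSpace X] {A : Set X} {n : ℕ → ℕ} {r : ℕ → ℝ} {N : ℕ} {C : ℝ}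
  {q : ℕ → X → Set X}

lemma isCompact_of_isPiece (hq : ClusterTree A n r N C q) (hA : IsCompact A) {s t : ℕ}
    {p : Set X} (hp : IsPiece A q s t p) (hr : 0 < r t) : IsCompact p := by
  have hpe : p = A \ ⋃ y ∈ A \ p, Metric.ball y (r t) := by
    ext x
    constructor
    · refine fun hx => ⟨hp.subset hx, fun hmem => ?_⟩
      obtain ⟨y, ⟨hyA, hyp⟩, hxy⟩ := Set.mem_iUnion₂.1 hmem
      refine absurd (Metric.mem_ball.1 hxy) (not_lt.2 (hq.sep t x (hp.subset hx) y hyA fun h => ?_))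
      exact hyp (hp.saturated x hx y hyA h)
    · rintro ⟨hxA, hx⟩
      by_contra hxp
      exact hx (Set.mem_iUnion₂.2 ⟨x, ⟨hxA, hxp⟩, Metric.mem_ball_self hr⟩)
  rw [hpe]
  exact hA.diff (isOpen_biUnion fun y _ => Metric.isOpen_ball)

/-- A piece splits into any number `K` of smaller pieces compatible with the cluster counts. -/
lemma exists_split (hq : ClusterTree A n r N C q) (hN : 0 < N) {s t s' t' : ℕ} (hs : s ≤ s')
    (ht : t ≤ t') (hst : s' ≤ t') {p : Set X} (hp : IsPiece A q s t p) {K : ℕ}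
    (hK : N * ∏ i ∈ Finset.Ico s s', n i ≤ K) (hK' : N * K ≤ ∏ i ∈ Finset.Ico t t', n i) :
    ∃ F : Fin K → Set X, (∀ i, F i ⊆ p ∧ IsPiece A q s' t' (F i)) ∧ (∀ x ∈ p, ∃ i, x ∈ F i) ∧
      ∀ i j, i ≠ j → ∀ x ∈ F i, ∀ y ∈ F j, r t' ≤ dist x y := by
  obtain ⟨x₀, hx₀⟩ := hp.nonempty
  have hx₀A := hp.subset hx₀
  have hsub : p ⊆ {y ∈ A | q s y = q s x₀} := fun y hy =>
    ⟨hp.subset hy, hp.eq_of_mem y hy x₀ hx₀⟩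
  have hsup : {y ∈ A | q t y = q t x₀} ⊆ p := fun y hy =>
    hp.saturated x₀ hx₀ y hy.1 hy.2.symm
  obtain ⟨hfin, hcard⟩ := hq.upper s s' hs x₀ hx₀A
  have hfin' := (hq.upper s t' (hs.trans hst) x₀ hx₀A).1.subset (Set.image_mono hsub)
  have hlow := hq.lower t t' ht x₀ hx₀A
  obtain ⟨φ, hφ1, hφ2, hφ3⟩ := exists_coloring (K := K) hp.nonempty (u := q s') (v := q t')
    (fun x hx y hy => hq.refine s' t' hst x (hp.subset hx) y (hp.subset hy)) hfin'
    (hfin.subset (Set.image_mono hsub))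
    (((Set.ncard_le_ncard (Set.image_mono hsub) hfin).trans hcard).trans hK)
    ((Nat.le_of_mul_le_mul_left (hK'.trans hlow) hN).trans
      (Set.ncard_le_ncard (Set.image_mono hsup) hfin'))
  refine ⟨fun i => {x ∈ p | φ x = i}, fun i => ⟨fun x hx => hx.1, fun x hx => hp.subset hx.1,
    hφ1 i, ?_, ?_⟩, fun x hx => ⟨φ x, hx, rfl⟩, ?_⟩
  · rintro x ⟨hx, rfl⟩ y hy hxy
    have hyp := hp.saturated x hx y hy (hq.refine t t' ht x (hp.subset hx) y hy hxy)
    exact ⟨hyp, (hφ2 x hx y hyp hxy).symm⟩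
  · rintro x ⟨hx, hxi⟩ y ⟨hy, hyi⟩
    exact hφ3 x hx y hy (hxi.trans hyi.symm)
  · rintro i j hij x ⟨hx, rfl⟩ y ⟨hy, rfl⟩
    exact hq.sep t' x (hp.subset hx) y (hp.subset hy) fun h => hij (hφ2 x hx y hy h)

/-- Two cluster trees with compatible counts along suitable levels can be matched. -/
lemma exists_bijOn (hq : ClusterTree A n r N C q) (hA : IsCompact A) (hAne : A.Nonempty)
    (hr : ∀ j, 0 < r j) (hN : 0 < N) {Y : Type*} [MetricSpace Y] {B : Set Y} {n₂ : ℕ → ℕ}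
    {r₂ : ℕ → ℝ} {N₂ : ℕ} {C₂ : ℝ} {q₂ : ℕ → Y → Set Y} (hq₂ : ClusterTree B n₂ r₂ N₂ C₂ q₂)
    (hB : IsCompact B) (hBne : B.Nonempty) (hr₂ : ∀ j, 0 < r₂ j) (hN₂ : 0 < N₂)
    {s t s₂ t₂ K : ℕ → ℕ} (hs : Monotone s) (ht : Monotone t) (hst : ∀ k, s k ≤ t k)
    (hs₂ : Monotone s₂) (ht₂ : Monotone t₂) (hst₂ : ∀ k, s₂ k ≤ t₂ k) (hs0 : s 0 = 0)
    (hs0₂ : s₂ 0 = 0) (hβ : Tendsto (fun k => C * r (s k)) atTop (nhds 0))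
    (hβ₂ : Tendsto (fun k => C₂ * r₂ (s₂ k)) atTop (nhds 0))
    (hK : ∀ k, N * ∏ i ∈ Finset.Ico (s k) (s (k + 1)), n i ≤ K k)
    (hK' : ∀ k, N * K k ≤ ∏ i ∈ Finset.Ico (t k) (t (k + 1)), n i)
    (hK₂ : ∀ k, N₂ * ∏ i ∈ Finset.Ico (s₂ k) (s₂ (k + 1)), n₂ i ≤ K k)
    (hK₂' : ∀ k, N₂ * K k ≤ ∏ i ∈ Finset.Ico (t₂ k) (t₂ (k + 1)), n₂ i) :
    ∃ f : X → Y, Set.BijOn f A B ∧ ∀ x ∈ A, ∀ x' ∈ A, x ≠ x' → ∃ k,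
      r (t (k + 1)) ≤ dist x x' ∧ dist x x' ≤ C * r (s k) ∧
      r₂ (t₂ (k + 1)) ≤ dist (f x) (f x') ∧ dist (f x) (f x') ≤ C₂ * r₂ (s₂ k) := by
  let Good : ℕ → Set X → Set Y → Prop := fun k p p₂ =>
    IsPiece A q (s k) (t k) p ∧ IsPiece B q₂ (s₂ k) (t₂ k) p₂
  obtain ⟨f, hfm, hf, hsurj⟩ := exists_matching (A := A) (B := B) (Q₀ := B) Good
    (α := fun k => r (t (k + 1))) (β := fun k => C * r (s k))
    (α' := fun k => r₂ (t₂ (k + 1))) (β' := fun k => C₂ * r₂ (s₂ k)) True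
    ⟨⟨subset_rfl, hAne, fun _ _ y hy _ => hy, by rw [hs0]; exact hq.zero⟩,
      ⟨subset_rfl, hBne, fun _ _ y hy _ => hy, by rw [hs0₂]; exact hq₂.zero⟩⟩
    (by
      rintro k p p₂ ⟨hp, hp₂⟩
      obtain ⟨F, hF1, hF2, hF3⟩ := hq.exists_split hN (hs k.le_succ) (ht k.le_succ)
        (hst (k + 1)) hp (hK k) (hK' k)
      obtain ⟨F₂, hF₂1, hF₂2, hF₂3⟩ := hq₂.exists_split hN₂ (hs₂ k.le_succ) (ht₂ k.le_succ)
        (hst₂ (k + 1)) hp₂ (hK₂ k) (hK₂' k)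
      refine ⟨Set.range fun i => (F i, F₂ i), ?_, ?_, fun _ => ?_, ?_⟩
      · rintro _ ⟨i, rfl⟩
        exact ⟨⟨(hF1 i).2, (hF₂1 i).2⟩, (hF1 i).1, (hF₂1 i).1⟩
      · intro x hx
        obtain ⟨i, hi⟩ := hF2 x hx
        exact ⟨_, ⟨i, rfl⟩, hi⟩
      · intro y hy
        obtain ⟨i, hi⟩ := hF₂2 y hy
        exact ⟨_, ⟨i, rfl⟩, hi⟩
      · rintro _ ⟨i, rfl⟩ _ ⟨j, rfl⟩ hne
        have hij : i ≠ j := fun h => hne (by rw [h])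
        exact ⟨hF3 i j hij, hF₂3 i j hij⟩)
    (by
      rintro k p p₂ ⟨hp, hp₂⟩
      exact ⟨fun x hx x' hx' => hq.diam _ x (hp.subset hx) x' (hp.subset hx')
          (hp.eq_of_mem x hx x' hx'),
        fun y hy y' hy' => hq₂.diam _ y (hp₂.subset hy) y' (hp₂.subset hy')
          (hp₂.eq_of_mem y hy y' hy')⟩)
    (fun k p p₂ hg => ⟨hq₂.isCompact_of_isPiece hB hg.2 (hr₂ _), hg.2.nonempty⟩)
    (fun _ k p p₂ hg => ⟨hq.isCompact_of_isPiece hA hg.1 (hr _), hg.1.nonempty⟩)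
    (fun k => hr _) hβ hβ₂
    (by
      intro y hy
      obtain ⟨p, p₂, hg, hyp⟩ := hy 0
      exact hg.2.subset hyp)
  refine ⟨f, ⟨hfm, fun x hx x' hx' hfx => ?_, hsurj trivial subset_rfl⟩, hf⟩
  by_contra hne
  obtain ⟨k, -, -, h3, -⟩ := hf x hx x' hx' hne
  rw [hfx, dist_self] at h3
  exact absurd (hr₂ _) (not_lt.2 h3)

end ClusterTree

lemma MoranData.mul_mul_prod_Ico_le {n : ℕ → ℕ} {c : ℕ → ℝ} {D : ℝ} {M : ℕ} {c₀ γ : ℝ}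
    (h : MoranData n c D M c₀ γ) {n₂ : ℕ → ℕ} {c₂ : ℕ → ℝ} {D₂ : ℝ} {M₂ : ℕ} {c₀₂ γ₂ : ℝ}
    (h₂ : MoranData n₂ c₂ D₂ M₂ c₀₂ γ₂) {a b : ℕ} (ha : 0 < a) (hb : 0 < b) {u w v z : ℝ}
    (hu : 0 ≤ u) (huw : u ≤ w) (hv : 0 ≤ v) (hvz : v ≤ z)
    (hle : Real.log a + Real.log b + Real.log M + Real.log M₂ + (w - u) ≤ z - v) :
    a * (b * ∏ i ∈ Finset.Ico (growthLevel n u) (growthLevel n w), n i) ≤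
      ∏ i ∈ Finset.Ico (growthLevel n₂ v) (growthLevel n₂ z), n₂ i := by
  have h1 := h.le_log_prodN_growthLevel u
  have h2 := h.log_prodN_growthLevel_le (hu.trans huw)
  have h3 := h₂.le_log_prodN_growthLevel z
  have h4 := h₂.log_prodN_growthLevel_le hv
  have h5 := h.log_prod_Ico (h.growthLevel_mono huw)
  have h6 := h₂.log_prod_Ico (h₂.growthLevel_mono hvz)
  have hp := h.prod_Ico_pos (growthLevel n u) (growthLevel n w)
  have hp₂ := h₂.prod_Ico_pos (growthLevel n₂ v) (growthLevel n₂ z)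
  have h7 : Real.log
      ((a * (b * ∏ i ∈ Finset.Ico (growthLevel n u) (growthLevel n w), n i) : ℕ) : ℝ) ≤
      Real.log ((∏ i ∈ Finset.Ico (growthLevel n₂ v) (growthLevel n₂ z), n₂ i : ℕ) : ℝ) := by
    rw [Nat.cast_mul, Nat.cast_mul b, Real.log_mul (by positivity) (by positivity),
      Real.log_mul (by positivity) (by positivity), h5, h6]
    linarith
  exact_mod_cast (Real.log_le_log_iff (by positivity) (by positivity)).1 h7

lemma Nat.mul_max_le {a x y z : ℕ} (hx : a * x ≤ z) (hy : a * y ≤ z) : a * max x y ≤ z := by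
  rcases max_choice x y with h | h <;> rwa [h]

lemma eventually_linear_le_quadratic {κ L T η : ℝ} (hκ : 0 ≤ κ) (hL : 0 < L) (hT : 0 ≤ T)
    (hη : 0 < η) : ∀ᶠ k : ℕ in atTop,
      κ * (L * (k + 1) * (k + 2) - L * k ^ 2) + T ≤ η * (L * (k : ℝ) ^ 2) := by
  filter_upwards [tendsto_natCast_atTop_atTop.eventually_ge_atTop ((5 * κ * L + T) / (η * L)),
    eventually_ge_atTop 1] with k hk hk1
  have hk1 : (1 : ℝ) ≤ k := by exact_mod_cast hk1
  rw [div_le_iff₀ (by positivity)] at hk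
  have h1 := mul_le_mul_of_nonneg_right hk (by linarith : (0 : ℝ) ≤ k)
  have h2 : 0 ≤ κ * L * (k - 1) := mul_nonneg (by positivity) (by linarith)
  have h3 : 0 ≤ T * (k - 1) := mul_nonneg hT (by linarith)
  nlinarith

/-- Uniformly disconnected Moran sets admit a bijection which is controlled along a quadratic
sequence of growth levels. -/
lemma MoranCoding.exists_bijOn_logScale {X Y : Type*} [MetricSpace X] [MetricSpace Y]
    {A : Set X}
    {n : ℕ → ℕ} {c : ℕ → ℝ} {D : ℝ} {P : ℕ → (∀ i, Fin (n i)) → Set X} {M : ℕ} {c₀ γ : ℝ}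
    (hd : MoranData n c D M c₀ γ) (h : MoranCoding A n c D P) (hA : UnifDisconn A)
    {B : Set Y} {n₂ : ℕ → ℕ} {c₂ : ℕ → ℝ} {D₂ : ℝ} {P₂ : ℕ → (∀ i, Fin (n₂ i)) → Set Y} {M₂ : ℕ}
    {c₀₂ γ₂ : ℝ} (hd₂ : MoranData n₂ c₂ D₂ M₂ c₀₂ γ₂) (h₂ : MoranCoding B n₂ c₂ D₂ P₂)
    (hB : UnifDisconn B) :
    ∃ (L C C₂ : ℝ) (f : X → Y), 0 < L ∧ 1 ≤ C ∧ 1 ≤ C₂ ∧ Set.BijOn f A B ∧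
      ∀ x ∈ A, ∀ x' ∈ A, x ≠ x' → ∃ k : ℕ,
        Real.exp (-logScale n c D (L * (k + 1) * (k + 2))) ≤ dist x x' ∧
        dist x x' ≤ C * Real.exp (-logScale n c D (L * (k : ℝ) ^ 2)) ∧
        Real.exp (-logScale n₂ c₂ D₂ (L * (k + 1) * (k + 2))) ≤ dist (f x) (f x') ∧
        dist (f x) (f x') ≤ C₂ * Real.exp (-logScale n₂ c₂ D₂ (L * (k : ℝ) ^ 2)) := by
  obtain ⟨N, C, q, hN, hC, hq⟩ := h.exists_clusterTree hd hA
  obtain ⟨N₂, C₂, q₂, hN₂, hC₂, hq₂⟩ := h₂.exists_clusterTree hd₂ hB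
  obtain ⟨x₀, hx₀, -⟩ := h.exists_point fun i => ⟨0, by have := hd.two_le i; omega⟩
  obtain ⟨y₀, hy₀, -⟩ := h₂.exists_point fun i => ⟨0, by have := hd₂.two_le i; omega⟩
  have hM := hd.log_M_pos
  have hM₂ := hd₂.log_M_pos
  have hlN : 0 ≤ Real.log N := Real.log_natCast_nonneg N
  have hlN₂ : 0 ≤ Real.log N₂ := Real.log_natCast_nonneg N₂
  set L := 2 * Real.log N + 2 * Real.log N₂ + 2 * Real.log M + 2 * Real.log M₂ with hL
  have hL0 : 0 < L := by linarith
  set u : ℕ → ℝ := fun k => L * (k : ℝ) ^ 2 with hu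
  set v : ℕ → ℝ := fun k => L * k * (k + 1) with hv
  have hu0 : ∀ k, 0 ≤ u k := fun k => by positivity
  have hv0 : ∀ k, 0 ≤ v k := fun k => by positivity
  have huv : ∀ k, u k ≤ v k := fun k => by
    have : 0 ≤ L * k := by positivity
    simp only [hu, hv]
    linarith
  have hum : Monotone u := fun j k hjk => by
    have : (j : ℝ) ≤ k := by exact_mod_cast hjk
    simp only [hu]
    gcongr
  have hvm : Monotone v := fun j k hjk => by
    have : (j : ℝ) ≤ k := by exact_mod_cast hjk
    simp only [hv]
    gcongr
  have huvL : ∀ k, L + (u (k + 1) - u k) = v (k + 1) - v k := fun k => by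
    simp only [hu, hv]
    push_cast
    ring
  have hut : Tendsto u atTop atTop :=
    ((tendsto_pow_atTop two_ne_zero).comp tendsto_natCast_atTop_atTop).const_mul_atTop hL0
  have hu00 : u 0 = 0 := by simp [hu]
  have hscale : ∀ {n : ℕ → ℕ} {c : ℕ → ℝ} {D : ℝ} {M : ℕ} {c₀ γ : ℝ} (w : ℝ),
      MoranData n c D M c₀ γ →
      prodC c (growthLevel n w) * D = Real.exp (-logScale n c D w) := by
    intro n c D M c₀ γ w h
    rw [logScale, neg_neg, Real.exp_log (mul_pos (h.prodC_pos _) h.D_pos)]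
  have htend : ∀ {n : ℕ → ℕ} {c : ℕ → ℝ} {D : ℝ} {M : ℕ} {c₀ γ : ℝ} (C : ℝ),
      MoranData n c D M c₀ γ →
      Tendsto (fun k => C * (prodC c (growthLevel n (u k)) * D)) atTop (nhds 0) := by
    intro n c D M c₀ γ C h
    simp only [hscale _ h]
    have := Real.tendsto_exp_atBot.comp
      (tendsto_neg_atTop_atBot.comp (h.tendsto_logScale.comp hut))
    simpa using this.const_mul C
  obtain ⟨f, hf, hdist⟩ := hq.exists_bijOn h.compact_set ⟨x₀, hx₀⟩
    (fun j => mul_pos (hd.prodC_pos j) hd.D_pos) hN hq₂ h₂.compact_set ⟨y₀, hy₀⟩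
    (fun j => mul_pos (hd₂.prodC_pos j) hd₂.D_pos) hN₂
    (s := fun k => growthLevel n (u k)) (t := fun k => growthLevel n (v k))
    (s₂ := fun k => growthLevel n₂ (u k)) (t₂ := fun k => growthLevel n₂ (v k))
    (K := fun k => max
      (N * ∏ i ∈ Finset.Ico (growthLevel n (u k)) (growthLevel n (u (k + 1))), n i)
      (N₂ * ∏ i ∈ Finset.Ico (growthLevel n₂ (u k)) (growthLevel n₂ (u (k + 1))), n₂ i))
    (fun j k hjk => hd.growthLevel_mono (hum hjk)) (fun j k hjk => hd.growthLevel_mono (hvm hjk))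
    (fun k => hd.growthLevel_mono (huv k)) (fun j k hjk => hd₂.growthLevel_mono (hum hjk))
    (fun j k hjk => hd₂.growthLevel_mono (hvm hjk)) (fun k => hd₂.growthLevel_mono (huv k))
    (by rw [hu00, growthLevel_zero]) (by rw [hu00, growthLevel_zero]) (htend C hd) (htend C₂ hd₂)
    (fun k => le_max_left _ _)
    (fun k => by
      have := huvL k
      refine Nat.mul_max_le ?_ ?_
      · exact hd.mul_mul_prod_Ico_le hd hN hN (hu0 k) (hum k.le_succ) (hv0 k) (hvm k.le_succ)
          (by linarith)
      · exact hd₂.mul_mul_prod_Ico_le hd hN hN₂ (hu0 k) (hum k.le_succ) (hv0 k)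
          (hvm k.le_succ) (by linarith))
    (fun k => le_max_right _ _)
    (fun k => by
      have := huvL k
      refine Nat.mul_max_le ?_ ?_
      · exact hd.mul_mul_prod_Ico_le hd₂ hN₂ hN (hu0 k) (hum k.le_succ) (hv0 k)
          (hvm k.le_succ) (by linarith)
      · exact hd₂.mul_mul_prod_Ico_le hd₂ hN₂ hN₂ (hu0 k) (hum k.le_succ) (hv0 k)
          (hvm k.le_succ) (by linarith))
  refine ⟨L, C, C₂, f, hL0, hC, hC₂, hf, fun x hx x' hx' hne => ?_⟩
  obtain ⟨k, h1, h2, h3, h4⟩ := hdist x hx x' hx' hne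
  have hvk : v (k + 1) = L * (k + 1) * (k + 2) := by
    simp only [hv]
    push_cast
    ring
  simp only [hscale _ hd, hscale _ hd₂, hvk] at h1 h2 h3 h4
  exact ⟨k, h1, h2, h3, h4⟩

/-- Uniformly disconnected Moran sets whose logarithmic growth functions are asymptotic are
quasi-Lipschitz equivalent. -/
lemma MoranCoding.quasiLipEquiv_of_tendsto {X Y : Type*} [MetricSpace X] [MetricSpace Y]
    {A : Set X}
    {n : ℕ → ℕ} {c : ℕ → ℝ} {D : ℝ} {P : ℕ → (∀ i, Fin (n i)) → Set X} {M : ℕ} {c₀ γ : ℝ}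
    (hd : MoranData n c D M c₀ γ) (h : MoranCoding A n c D P) (hA : UnifDisconn A)
    {B : Set Y} {n₂ : ℕ → ℕ} {c₂ : ℕ → ℝ} {D₂ : ℝ} {P₂ : ℕ → (∀ i, Fin (n₂ i)) → Set Y} {M₂ : ℕ}
    {c₀₂ γ₂ : ℝ} (hd₂ : MoranData n₂ c₂ D₂ M₂ c₀₂ γ₂) (h₂ : MoranCoding B n₂ c₂ D₂ P₂)
    (hB : UnifDisconn B)
    (hlim : Tendsto (fun r : ℝ => Real.log (Phi n c D r : ℝ) / Real.log (Phi n₂ c₂ D₂ r : ℝ))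
      (nhdsWithin (0 : ℝ) (Set.Ioi 0)) (nhds 1)) :
    QuasiLipEquiv A B := by
  obtain ⟨L, C, C₂, f, hL0, hC, hC₂, hf, hdist⟩ := h.exists_bijOn_logScale hd hA hd₂ h₂ hB
  have hlC : 0 ≤ Real.log C := Real.log_nonneg hC
  have hlC₂ : 0 ≤ Real.log C₂ := Real.log_nonneg hC₂
  have hut : Tendsto (fun k : ℕ => L * (k : ℝ) ^ 2) atTop atTop :=
    ((tendsto_pow_atTop two_ne_zero).comp tendsto_natCast_atTop_atTop).const_mul_atTop hL0
  refine ⟨f, hf, fun ε hε => ?_⟩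
  obtain ⟨κ, κ', hκ, hκ', hgap⟩ := hd.exists_logScale_sub_le
  obtain ⟨κ₂, κ₂', hκ₂, hκ₂', hgap₂⟩ := hd₂.exists_logScale_sub_le
  obtain ⟨a, b, ha, hab⟩ := hd.exists_le_logScale
  have hη : 0 < ε * a / 8 := by positivity
  have hev := (hut.eventually (hd.eventually_abs_logScale_sub_le hd₂ hlim hη)).and <|
    (eventually_linear_le_quadratic hκ.le hL0 (add_nonneg hκ'.le hlC) hη).and <|
    (eventually_linear_le_quadratic hκ₂.le hL0 (add_nonneg hκ₂'.le hlC₂) hη).and <|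
    (hut.eventually_ge_atTop ((b + Real.log C) / (a / 2))).and (hut.eventually_gt_atTop 0)
  obtain ⟨k₀, hk₀⟩ := eventually_atTop.1 hev
  refine ⟨Real.exp (-logScale n c D (L * (k₀ + 1) * (k₀ + 2))), Real.exp_pos _,
    fun x hx x' hx' hpos hlt => ?_⟩
  obtain ⟨k, h1, h2, h3, h4⟩ := hdist x hx x' hx' (dist_pos.1 hpos)
  have hk : k₀ ≤ k := by
    by_contra hlt'
    have h5 : (k : ℝ) ≤ k₀ := by exact_mod_cast (not_le.1 hlt').le
    have h6 : L * (k + 1) * (k + 2) ≤ L * (k₀ + 1) * (k₀ + 2) := by gcongr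
    have h7 := Real.exp_lt_exp.1 (h1.trans_lt hlt)
    have h8 := hd.logScale_mono h6
    linarith
  obtain ⟨g1, g2, g3, g4, g5⟩ := hk₀ k hk
  have huw : L * (k : ℝ) ^ 2 ≤ L * (k + 1) * (k + 2) := by
    have : 0 ≤ L * k := by positivity
    linarith
  generalize L * (k : ℝ) ^ 2 = u at *
  generalize L * ((k : ℝ) + 1) * (k + 2) = w at *
  rw [div_le_iff₀ (by positivity)] at g4
  have hg := hgap (u) (w) g5.le huw
  have hg₂ := hgap₂ (u) (w) g5.le huw
  have hal := hab (u)
  have hpos' : 0 < dist (f x) (f x') := (Real.exp_pos _).trans_le h3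
  have l1 := Real.log_le_log (Real.exp_pos _) h1
  have l2 := Real.log_le_log hpos h2
  have l3 := Real.log_le_log (Real.exp_pos _) h3
  have l4 := Real.log_le_log hpos' h4
  rw [Real.log_exp] at l1 l3
  rw [Real.log_mul (by positivity) (Real.exp_pos _).ne', Real.log_exp] at l2 l4
  obtain ⟨g6, g7⟩ := abs_le.1 g1
  have hm : 0 ≤ κ * (w - u) := mul_nonneg hκ.le (by linarith)
  have hm₂ : 0 ≤ κ₂ * (w - u) := mul_nonneg hκ₂.le (by linarith)
  have hneg : Real.log (dist x x') ≤ -(a / 2 * u) := by linarith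
  have hneg0 : Real.log (dist x x') < 0 := by
    have : 0 < a / 2 * u := by positivity
    linarith
  have hεneg := mul_le_mul_of_nonneg_left hneg hε.le
  have hpos8 : 0 < ε * a / 8 * u := by positivity
  rw [abs_lt, lt_sub_iff_add_lt, sub_lt_iff_lt_add, lt_div_iff_of_neg hneg0,
    div_lt_iff_of_neg hneg0]
  constructor <;> nlinarith

/-- Results on Moran classes `𝒜 = M(J,{n_k},{c_k})` and `ℬ = M(I,{m_k},{d_k})`:
(i) if `limsup_k log(n_{k+1}⋯n_{k+k₀})/(−log(c_{k+1}⋯c_{k+k₀})) < 1` for some `k₀ ≥ 1`,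
then every `E ∈ 𝒜` is uniformly disconnected;
(ii) if `E ∈ 𝒜` is uniformly disconnected and
`sup_{r' < r₀ r < r < r₀} log Φ_𝒜(r,r')/log Φ_ℬ(r,r') < 1` for some `r₀ < 1`, then
`E` embeds bilipschitzly into every `F ∈ ℬ`;
(iii) if `E ∈ 𝒜` and `F ∈ ℬ` are uniformly disconnected, they are quasi-Lipschitz
equivalent iff `lim_{r→0} log Φ_𝒜(r)/log Φ_ℬ(r) = 1`. -/
theorem statement18 {d₁ d₂ : ℕ} (J : Set (EuclideanSpace ℝ (Fin d₁))) (n : ℕ → ℕ)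
    (c : ℕ → ℝ) (I : Set (EuclideanSpace ℝ (Fin d₂))) (m : ℕ → ℕ) (e : ℕ → ℝ) :
    ((∃ k₀ : ℕ, 1 ≤ k₀ ∧
        Filter.limsup (fun k : ℕ =>
          Real.log (∏ i ∈ Finset.Ico k (k + k₀), (n i : ℝ)) /
            (-Real.log (∏ i ∈ Finset.Ico k (k + k₀), c i))) Filter.atTop < 1) →
      ∀ Jw : List ℕ → Set (EuclideanSpace ℝ (Fin d₁)),
        IsMoranSystem J n c Jw → UnifDisconn (moranSet n Jw)) ∧
    (∀ Jw : List ℕ → Set (EuclideanSpace ℝ (Fin d₁)),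
      IsMoranSystem J n c Jw → UnifDisconn (moranSet n Jw) →
      (∃ r₀ : ℝ, 0 < r₀ ∧ r₀ < 1 ∧ ∃ b : ℝ, b < 1 ∧
        ∀ r r' : ℝ, 0 < r' → r' < r₀ * r → r < r₀ →
          Real.log ((Phi n c (Metric.diam J) r' : ℝ) / (Phi n c (Metric.diam J) r : ℝ)) /
            Real.log ((Phi m e (Metric.diam I) r' : ℝ) / (Phi m e (Metric.diam I) r : ℝ)) ≤ b) →
      ∀ Iw : List ℕ → Set (EuclideanSpace ℝ (Fin d₂)),
        IsMoranSystem I m e Iw → BilipEmbed (moranSet n Jw) (moranSet m Iw)) ∧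
    (∀ (Jw : List ℕ → Set (EuclideanSpace ℝ (Fin d₁)))
        (Iw : List ℕ → Set (EuclideanSpace ℝ (Fin d₂))),
      IsMoranSystem J n c Jw → IsMoranSystem I m e Iw →
      UnifDisconn (moranSet n Jw) → UnifDisconn (moranSet m Iw) →
      (QuasiLipEquiv (moranSet n Jw) (moranSet m Iw) ↔
        Filter.Tendsto (fun r : ℝ => Real.log (Phi n c (Metric.diam J) r : ℝ) /
            Real.log (Phi m e (Metric.diam I) r : ℝ))
          (nhdsWithin (0 : ℝ) (Set.Ioi 0)) (nhds 1))) := by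
  refine ⟨?_, ?_, ?_⟩
  · rintro ⟨k₀, hk₀, hlim⟩ Jw h
    obtain ⟨M, c₀, γ, hd⟩ := h.exists_moranData
    obtain ⟨s, K, hs0, hs1, hexp⟩ := hd.exists_exponent hk₀ hlim
    exact h.moranCoding.unifDisconn hd hs0 hs1 hexp
  · rintro Jw h hA ⟨r₀, hr₀, hr₀1, b, hb, hratio⟩ Iw h₂
    obtain ⟨M, c₀, γ, hd⟩ := h.exists_moranData
    obtain ⟨M₂, c₀₂, γ₂, hd₂⟩ := h₂.exists_moranData
    exact h.moranCoding.bilipEmbed hd hA hd₂ h₂.moranCoding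
      fun R => hd.log_Phi_sub_le_mul hd₂ hr₀ hr₀1 hb hratio R
  · intro Jw Iw h h₂ hA hB
    obtain ⟨M, c₀, γ, hd⟩ := h.exists_moranData
    obtain ⟨M₂, c₀₂, γ₂, hd₂⟩ := h₂.exists_moranData
    exact ⟨h.moranCoding.tendsto_of_quasiLipEquiv hd hd₂ h₂.moranCoding,
      h.moranCoding.quasiLipEquiv_of_tendsto hd hA hd₂ h₂.moranCoding hB⟩

end
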